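/- arXiv:1105.3564 — 8 statements merged into one kernel-verified Lean document; each statement's English description precedes it below -/
import Mathlib

section
/- Let G be a finite simple connected graph and let {α,β} ∈ E(G) be a whisker (an edge one of whose endpoints, say β, has degree one in G). Let H be the subgraph of G obtained from G by deleting the edge {α,β} and removing the free vertex β. Then, inside the polynomial ring S associated to G, the monomial cut ideal satisfies I(G) = I(H) ∩ (s_{αβ}, t_{αβ}). -/
open MvPolynomial

/-- Indicator: does the edge `e` cross the partition `A | Aᶜ`? -/
def crossBool {V : Type} [DecidableEq V] (A : Finset V) : Sym2 V → Bool :=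
  Sym2.lift ⟨fun i j => xor (decide (i ∈ A)) (decide (j ∈ A)), fun i j => Bool.xor_comm _ _⟩

/-- The cut monomial `u_{A|B}` (with `B = Aᶜ`), formed from the edges in `E'`,
viewed in the polynomial ring `S` on variables `s_e = X (e, true)`, `t_e = X (e, false)`
indexed by the edges of the ambient graph `G`. -/
noncomputable def cutGen (k : Type) [Field k] {V : Type} [DecidableEq V]
    (G : SimpleGraph V) (E' : Finset (Sym2 V)) (hE' : ↑E' ⊆ G.edgeSet) (A : Finset V) :
    MvPolynomial (↥G.edgeSet × Bool) k :=
  ∏ e ∈ E'.attach, X (⟨⟨e.1, hE' e.2⟩, crossBool A e.1⟩ : ↥G.edgeSet × Bool)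

/-- The monomial cut ideal of the subgraph of `G` with edge set `E'`,
viewed as an ideal of the polynomial ring associated to `G`. -/
noncomputable def cutIdealOn (k : Type) [Field k] {V : Type} [DecidableEq V]
    (G : SimpleGraph V) (E' : Finset (Sym2 V)) (hE' : ↑E' ⊆ G.edgeSet) :
    Ideal (MvPolynomial (↥G.edgeSet × Bool) k) :=
  Ideal.span (Set.range (cutGen k G E' hE'))

/-- The monomial cut ideal `I(G)` of the graph `G`. -/
noncomputable def cutIdeal (k : Type) [Field k] {V : Type} [DecidableEq V]
    (G : SimpleGraph V) [Fintype G.edgeSet] :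
    Ideal (MvPolynomial (↥G.edgeSet × Bool) k) :=
  cutIdealOn k G G.edgeSet.toFinset (by simp)

theorem mem_cutIdealOn_iff (k : Type) [Field k] {V : Type} [DecidableEq V]
    (G : SimpleGraph V) (E' : Finset (Sym2 V)) (hE' : ↑E' ⊆ G.edgeSet)
    (x : MvPolynomial (↥G.edgeSet × Bool) k) :
    x ∈ cutIdealOn k G E' hE' ↔ ∀ m ∈ x.support, ∃ A : Finset V,
      ∀ (e : Sym2 V) (he : e ∈ E'),
        m (⟨⟨e, hE' he⟩, crossBool A e⟩ : ↥G.edgeSet × Bool) ≠ 0 := by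
  classical
  let d : Finset V → (↥G.edgeSet × Bool) →₀ ℕ := fun A =>
    ∑ e ∈ E'.attach, Finsupp.single (⟨⟨e.1, hE' e.2⟩, crossBool A e.1⟩ : ↥G.edgeSet × Bool) 1
  have hgen : ∀ A, cutGen k G E' hE' A = monomial (d A) 1 := by
    intro A
    simp only [cutGen, d, monomial_sum_one]
    rfl
  have hI : cutIdealOn k G E' hE' =
      Ideal.span ((fun s => monomial s (1 : k)) '' Set.range d) := by
    rw [cutIdealOn, ← Set.range_comp]
    congr 2
    funext A
    exact hgen A
  have hd : ∀ A m, d A ≤ m ↔ ∀ (e : Sym2 V) (he : e ∈ E'),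
        m (⟨⟨e, hE' he⟩, crossBool A e⟩ : ↥G.edgeSet × Bool) ≠ 0 := by
    intro A m
    have key : d A = ∑ p ∈ E'.attach.image
        (fun e => (⟨⟨e.1, hE' e.2⟩, crossBool A e.1⟩ : ↥G.edgeSet × Bool)),
        Finsupp.single p 1 := by
      rw [Finset.sum_image]
      intro a _ b _ h
      simp only [Prod.mk.injEq, Subtype.mk.injEq] at h
      exact Subtype.ext h.1
    have hval : ∀ p, d A p = if p ∈ E'.attach.image
        (fun e => (⟨⟨e.1, hE' e.2⟩, crossBool A e.1⟩ : ↥G.edgeSet × Bool)) then 1 else 0 := by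
      intro p
      rw [key, Finsupp.finsetSum_apply]
      simp only [Finsupp.single_apply, Finset.sum_ite_eq']
    rw [Finsupp.le_def]
    constructor
    · intro h e he
      have h1 := h (⟨⟨e, hE' he⟩, crossBool A e⟩ : ↥G.edgeSet × Bool)
      rw [hval, if_pos (Finset.mem_image.mpr ⟨⟨e, he⟩, Finset.mem_attach _ _, rfl⟩)] at h1
      omega
    · intro h p
      rw [hval]
      split_ifs with hp
      · obtain ⟨e, -, rfl⟩ := Finset.mem_image.mp hp
        exact Nat.one_le_iff_ne_zero.mpr (h e.1 e.2)
      · exact Nat.zero_le _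
  rw [hI, mem_ideal_span_monomial_image]
  simp only [Set.exists_range_iff, hd]

theorem crossBool_adjust {V : Type} [DecidableEq V] (A : Finset V) (α β : V) (hne : α ≠ β)
    (b : Bool) : ∃ A' : Finset V, crossBool A' s(α, β) = b ∧
      ∀ e : Sym2 V, β ∉ e → crossBool A' e = crossBool A e := by
  have aux : ∀ A' : Finset V, (∀ v, v ≠ β → (v ∈ A' ↔ v ∈ A)) →
      ∀ e : Sym2 V, β ∉ e → crossBool A' e = crossBool A e := by
    intro A' h e
    induction e with
    | _ x y =>
      intro hb
      simp only [Sym2.mem_iff, not_or] at hb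
      simp [crossBool, h x (Ne.symm hb.1), h y (Ne.symm hb.2)]
  by_cases hc : xor (decide (α ∈ A)) b = true
  · refine ⟨insert β A, ?_, aux _ ?_⟩
    · by_cases hA : α ∈ A <;> cases b <;> simp_all [crossBool]
    · intro v hv; simp [hv]
  · refine ⟨A.erase β, ?_, aux _ ?_⟩
    · by_cases hA : α ∈ A <;> cases b <;> simp_all [crossBool]
    · intro v hv; simp [hv]

/-- Let `G` be a finite simple connected graph and `{α, β} ∈ E(G)` a whisker,
with free vertex `β` (i.e. `β` has degree one).  If `H` is the subgraph obtained
from `G` by deleting the edge `{α, β}` (and removing the free vertex `β`), then,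
inside the polynomial ring associated to `G`,
`I(G) = I(H) ∩ (s_{αβ}, t_{αβ})`. -/
theorem monomial_cut_ideal_delete_whisker
    (k : Type) [Field k] {V : Type} [Fintype V] [DecidableEq V]
    (G : SimpleGraph V) [DecidableRel G.Adj] (hG : G.Connected)
    (α β : V) (hαβ : G.Adj α β) (hwhisker : G.degree β = 1) :
    cutIdeal k G =
      cutIdealOn k G (G.edgeFinset.erase s(α, β))
          (by intro e he; simp only [Finset.coe_erase, Set.mem_diff] at he
              exact (SimpleGraph.mem_edgeFinset.mp he.1)) ⊓
        Ideal.span {X (⟨⟨s(α, β), G.mem_edgeSet.mpr hαβ⟩, true⟩ : ↥G.edgeSet × Bool),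
                    X (⟨⟨s(α, β), G.mem_edgeSet.mpr hαβ⟩, false⟩ : ↥G.edgeSet × Bool)} := by
  have hβ : ∀ e ∈ G.edgeSet, e ≠ s(α, β) → β ∉ e := by
    intro e he hne hb
    obtain ⟨w, rfl⟩ := Sym2.mem_iff_exists.mp hb
    obtain ⟨u, _, hu⟩ := (G.degree_eq_one_iff_existsUnique_adj).mp hwhisker
    have h1 : w = u := hu w (G.mem_edgeSet.mp he)
    have h2 : α = u := hu α hαβ.symm
    exact hne (by rw [h1, h2, Sym2.eq_swap])
  ext x
  have hpair : ∀ p q : ↥G.edgeSet × Bool,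
      ({X p, X q} : Set (MvPolynomial (↥G.edgeSet × Bool) k)) = X '' {p, q} := by
    intro p q; rw [Set.image_pair]
  rw [Ideal.mem_inf, cutIdeal, hpair, mem_ideal_span_X_image]
  refine (mem_cutIdealOn_iff k G _ _ x).trans
    (Iff.trans ?_ (and_congr_left' (mem_cutIdealOn_iff k G _ _ x).symm))
  constructor
  · intro h
    refine ⟨fun m hm => ?_, fun m hm => ?_⟩
    · obtain ⟨A, hA⟩ := h m hm
      exact ⟨A, fun e he => hA e (by
        simpa using (Finset.mem_erase.mp he).2)⟩
    · obtain ⟨A, hA⟩ := h m hm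
      refine ⟨_, ?_, hA s(α, β) (by simpa using hαβ)⟩
      cases crossBool A s(α, β) <;> simp
  · rintro ⟨h1, h2⟩ m hm
    obtain ⟨A, hA⟩ := h1 m hm
    obtain ⟨p, hp, hmp⟩ := h2 m hm
    have hp' : ∃ b, p = (⟨⟨s(α, β), G.mem_edgeSet.mpr hαβ⟩, b⟩ : ↥G.edgeSet × Bool) := by
      rcases hp with rfl | rfl
      · exact ⟨_, rfl⟩
      · exact ⟨_, rfl⟩
    obtain ⟨b, rfl⟩ := hp'
    obtain ⟨A', hb, hA'⟩ := crossBool_adjust A α β hαβ.ne b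
    refine ⟨A', fun e he => ?_⟩
    by_cases hee : e = s(α, β)
    · subst hee
      rw [hb]; exact hmp
    · have heG : e ∈ G.edgeSet := by simpa using he
      rw [hA' e (hβ e heG hee)]
      exact hA e (Finset.mem_erase.mpr ⟨hee, SimpleGraph.mem_edgeFinset.mpr heG⟩)
end

section
/- Let G be a tree (a finite simple connected acyclic graph). Then I(G) = ⋂_{{i,j} ∈ E(G)} (s_{ij}, t_{ij}), and this is the minimal primary decomposition of I(G); in particular, the minimal primes of I(G) are exactly the ideals (s_{ij}, t_{ij}) for {i,j} ∈ E(G). -/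
open MvPolynomial

lemma tree_cut_surj {V : Type} [Fintype V] [DecidableEq V]
    (G : SimpleGraph V) [DecidableRel G.Adj] (hG : G.IsTree) (f : G.edgeSet → Bool) :
    ∃ A : Finset V, ∀ e : G.edgeSet, crossBool A e.1 = f e := by
  classical
  obtain ⟨r⟩ := hG.connected.nonempty
  let F : ((Finset.univ.erase r).powerset : Finset (Finset V)) → (G.edgeSet → Bool) :=
    fun A e => crossBool A.1 e.1
  have hinj : Function.Injective F := by
    rintro ⟨A, hA⟩ ⟨B, hB⟩ h
    have hadj : ∀ i j, G.Adj i j → ((i ∈ A ↔ i ∈ B) ↔ (j ∈ A ↔ j ∈ B)) := by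
      intro i j hij
      have h1 := congrFun h ⟨s(i, j), hij⟩
      simp only [F, crossBool, Sym2.lift_mk] at h1
      by_cases a : i ∈ A <;> by_cases b : i ∈ B <;> by_cases c : j ∈ A <;>
        by_cases d : j ∈ B <;> simp [a, b, c, d] at h1 ⊢
    have hwalk : ∀ i j, G.Walk i j → ((i ∈ A ↔ i ∈ B) ↔ (j ∈ A ↔ j ∈ B)) := by
      intro i j w
      induction w with
      | nil => rfl
      | cons hh _ ih => exact (hadj _ _ hh).trans ih
    have hrA : r ∉ A := fun hr => by
      simpa using (Finset.mem_powerset.1 hA) hr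
    have hrB : r ∉ B := fun hr => by
      simpa using (Finset.mem_powerset.1 hB) hr
    apply Subtype.ext
    ext v
    obtain ⟨w⟩ := hG.connected.preconnected r v
    exact (hwalk r v w).1 (by simp [hrA, hrB])
  have hcard : Fintype.card ((Finset.univ.erase r).powerset : Finset (Finset V))
      = Fintype.card (G.edgeSet → Bool) := by
    have h1 := hG.card_edgeFinset
    rw [Fintype.card_coe, Finset.card_powerset, Finset.card_erase_of_mem (Finset.mem_univ r),
      Fintype.card_fun, Fintype.card_bool, Finset.card_univ, ← h1, SimpleGraph.edgeFinset_card]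
    simp
  obtain ⟨A, hA⟩ := ((Fintype.bijective_iff_injective_and_card F).2 ⟨hinj, hcard⟩).2 f
  exact ⟨A.1, fun e => congrFun hA e⟩

lemma span_X_image_isPrime (k : Type) [Field k] {σ : Type} (s : Set σ) :
    (Ideal.span (X '' s : Set (MvPolynomial σ k))).IsPrime := by
  classical
  let φ : MvPolynomial σ k →ₐ[k] MvPolynomial σ k := aeval (fun i => if i ∈ s then 0 else X i)
  have h1 : ∀ p, p - φ p ∈ Ideal.span (X '' s : Set (MvPolynomial σ k)) := by
    intro p
    induction p using MvPolynomial.induction_on with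
    | C a => simp [φ]
    | add p q hp hq =>
      rw [map_add, add_sub_add_comm]
      exact Ideal.add_mem _ hp hq
    | mul_X p i hp =>
      have : p * X i - φ (p * X i) = (p - φ p) * X i + φ p * (X i - φ (X i)) := by
        rw [map_mul]; ring
      rw [this]
      refine Ideal.add_mem _ (Ideal.mul_mem_right _ _ hp) (Ideal.mul_mem_left _ _ ?_)
      by_cases hi : i ∈ s
      · simpa [φ, hi] using Ideal.subset_span (Set.mem_image_of_mem X hi)
      · simp [φ, hi]
  have h2 : Ideal.span (X '' s : Set (MvPolynomial σ k)) = RingHom.ker φ := by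
    apply le_antisymm
    · rw [Ideal.span_le]
      rintro _ ⟨i, hi, rfl⟩
      simp [φ, RingHom.mem_ker, hi]
    · intro p hp
      have := h1 p
      rwa [(RingHom.mem_ker).1 hp, sub_zero] at this
  rw [h2]
  exact RingHom.ker_isPrime _

lemma prod_X_dvd_monomial (k : Type) [Field k] {σ ι : Type} (T : Finset ι) (g : ι → σ)
    (hg : Function.Injective g) (m : σ →₀ ℕ) (c : k) (h : ∀ t ∈ T, m (g t) ≠ 0) :
    (∏ t ∈ T, X (g t) : MvPolynomial σ k) ∣ monomial m c := by
  classical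
  have : (∏ t ∈ T, X (g t) : MvPolynomial σ k)
      = monomial (∑ i ∈ T.image g, Finsupp.single i 1) 1 := by
    rw [monomial_sum_one, Finset.prod_image (fun a _ b _ hab => hg hab)]
    rfl
  rw [this, monomial_dvd_monomial]
  refine ⟨Or.inr fun i => ?_, one_dvd _⟩
  rw [Finsupp.finsetSum_apply]
  simp only [Finsupp.single_apply, Finset.sum_ite_eq']
  split_ifs with hi
  · obtain ⟨t, ht, rfl⟩ := Finset.mem_image.1 hi
    exact Nat.one_le_iff_ne_zero.2 (h t ht)
  · exact Nat.zero_le _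

lemma X_dvd_cutGen (k : Type) [Field k] {V : Type} [DecidableEq V]
    (G : SimpleGraph V) (E' : Finset (Sym2 V)) (hE' : ↑E' ⊆ G.edgeSet) (A : Finset V)
    (e : G.edgeSet) (he : e.1 ∈ E') :
    (X (e, crossBool A e.1) : MvPolynomial (↥G.edgeSet × Bool) k) ∣ cutGen k G E' hE' A := by
  obtain ⟨e, he2⟩ := e
  have h := Finset.dvd_prod_of_mem
    (fun e' : {x // x ∈ E'} =>
      (X (⟨⟨e'.1, hE' e'.2⟩, crossBool A e'.1⟩ : ↥G.edgeSet × Bool) :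
        MvPolynomial (↥G.edgeSet × Bool) k))
    (Finset.mem_attach E' ⟨e, he⟩)
  beta_reduce at h
  rw [cutGen]
  exact h

lemma cutGen_dvd_monomial (k : Type) [Field k] {V : Type} [DecidableEq V]
    (G : SimpleGraph V) (E' : Finset (Sym2 V)) (hE' : ↑E' ⊆ G.edgeSet) (A : Finset V)
    (m : ↥G.edgeSet × Bool →₀ ℕ) (c : k) (h : ∀ e : G.edgeSet, m (e, crossBool A e.1) ≠ 0) :
    cutGen k G E' hE' A ∣ monomial m c := by
  unfold cutGen
  apply prod_X_dvd_monomial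
  · intro a b hab
    have := congrArg (fun x => (x.1 : Sym2 V)) hab
    exact Subtype.ext this
  · intro t _
    exact h ⟨t.1, hE' t.2⟩

/-- If `G` is a tree, then `I(G) = ⋂_{{i,j} ∈ E(G)} (s_{ij}, t_{ij})`, and this is the
minimal primary decomposition: the minimal primes of `I(G)` are exactly the ideals
`(s_{ij}, t_{ij})` for the edges `{i,j}` of `G`. -/
theorem monomial_cut_ideal_tree_primary_decomposition
    (k : Type) [Field k] {V : Type} [Fintype V] [DecidableEq V]
    (G : SimpleGraph V) [DecidableRel G.Adj] (hG : G.IsTree) :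
    cutIdeal k G =
      ⨅ e : ↥G.edgeSet,
        Ideal.span {X ((e, true) : ↥G.edgeSet × Bool), X ((e, false) : ↥G.edgeSet × Bool)} ∧
    (cutIdeal k G).minimalPrimes =
      Set.range (fun e : ↥G.edgeSet =>
        Ideal.span {X ((e, true) : ↥G.edgeSet × Bool), X ((e, false) : ↥G.edgeSet × Bool)}) := by
  have hP : ∀ e : G.edgeSet,
      (Ideal.span {X ((e, true) : ↥G.edgeSet × Bool), X ((e, false) : ↥G.edgeSet × Bool)} :
        Ideal (MvPolynomial (↥G.edgeSet × Bool) k))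
      = Ideal.span (X '' {(e, true), (e, false)}) := fun e => by rw [Set.image_pair]
  have hprime : ∀ e : G.edgeSet,
      (Ideal.span {X ((e, true) : ↥G.edgeSet × Bool), X ((e, false) : ↥G.edgeSet × Bool)} :
        Ideal (MvPolynomial (↥G.edgeSet × Bool) k)).IsPrime := fun e => by
    rw [hP]; exact span_X_image_isPrime k _
  have hI : cutIdeal k G =
      ⨅ e : ↥G.edgeSet,
        Ideal.span {X ((e, true) : ↥G.edgeSet × Bool), X ((e, false) : ↥G.edgeSet × Bool)} := by
    apply le_antisymm
    · refine le_iInf fun e => ?_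
      rw [cutIdeal, cutIdealOn, Ideal.span_le]
      rintro _ ⟨A, rfl⟩
      refine Ideal.mem_of_dvd _ (X_dvd_cutGen k G _ _ A e (Set.mem_toFinset.2 e.2))
        (Ideal.subset_span ?_)
      cases crossBool A e.1 <;> simp
    · intro p hp
      rw [p.as_sum]
      refine Ideal.sum_mem _ fun m hm => ?_
      have h1 : ∀ e : G.edgeSet, ∃ b : Bool, m (e, b) ≠ 0 := by
        intro e
        have h2 := (Submodule.mem_iInf _).1 hp e
        rw [hP, mem_ideal_span_X_image] at h2
        obtain ⟨i, hi, hmi⟩ := h2 m hm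
        rcases hi with rfl | rfl
        · exact ⟨_, hmi⟩
        · exact ⟨_, hmi⟩
      choose f hf using h1
      obtain ⟨A, hA⟩ := tree_cut_surj G hG f
      refine Ideal.mem_of_dvd _ (cutGen_dvd_monomial k G _ _ A m _ fun e => ?_)
        (Ideal.subset_span ⟨A, rfl⟩)
      rw [hA e]
      exact hf e
  refine ⟨hI, ?_⟩
  have hle : ∀ Q : Ideal (MvPolynomial (↥G.edgeSet × Bool) k), Q.IsPrime → cutIdeal k G ≤ Q →
      ∃ e : G.edgeSet, Ideal.span
        {X ((e, true) : ↥G.edgeSet × Bool), X ((e, false) : ↥G.edgeSet × Bool)} ≤ Q := by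
    intro Q hQ h
    rw [hI, ← Finset.inf_univ_eq_iInf, hQ.inf_le'] at h
    obtain ⟨e, _, he⟩ := h
    exact ⟨e, he⟩
  have hge : ∀ e : G.edgeSet, cutIdeal k G ≤ Ideal.span
        {X ((e, true) : ↥G.edgeSet × Bool), X ((e, false) : ↥G.edgeSet × Bool)} := by
    intro e
    rw [hI]
    exact iInf_le _ e
  ext P
  constructor
  · rintro ⟨⟨hPp, hPI⟩, hmin⟩
    obtain ⟨e, he⟩ := hle P hPp hPI
    exact ⟨e, le_antisymm he (hmin ⟨hprime e, hge e⟩ he)⟩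
  · rintro ⟨e, rfl⟩
    refine ⟨⟨hprime e, hge e⟩, ?_⟩
    rintro Q ⟨hQ, hQI⟩ hQe
    obtain ⟨e', he'⟩ := hle Q hQ hQI
    have h5 : (X (e', true) : MvPolynomial (↥G.edgeSet × Bool) k) ∈ Ideal.span
        {X ((e, true) : ↥G.edgeSet × Bool), X ((e, false) : ↥G.edgeSet × Bool)} :=
      hQe (he' (Ideal.subset_span (by simp)))
    rw [hP, mem_ideal_span_X_image] at h5
    obtain ⟨i, hi, hmi⟩ := h5 (Finsupp.single (e', true) 1) (by simp [support_X])
    have : e = e' := by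
      have h6 : (e', true) = i := by
        by_contra hne
        exact hmi (Finsupp.single_eq_of_ne' hne)
      subst h6
      rcases hi with h | h
      · exact (congrArg Prod.fst h).symm
      · exact (congrArg Prod.fst h).symm
    subst this
    exact he'
end

section
/- Let T_r be the path graph on vertices {1,…,r+1} with edges {i,i+1} for 1 ≤ i ≤ r, where r ≥ 1. Then the monomial cut ideal I(T_r) has linear quotients: there is an ordering u_1, u_2, …, u_ℓ of the minimal monomial generators of I(T_r) such that for every k with 2 ≤ k ≤ ℓ, the colon ideal (u_1, …, u_{k−1}) : u_k is generated by a subset of the variables of S. -/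
open MvPolynomial

/-- exponent vector of the squarefree monomial attached to an assignment `f`. -/
noncomputable def expVec {E : Type} [Fintype E] (f : E → Bool) : (E × Bool) →₀ ℕ :=
  ∑ e, Finsupp.single (e, f e) 1

theorem expVec_apply {E : Type} [Fintype E] (f : E → Bool) (e : E) (b : Bool) :
    expVec f (e, b) = if f e = b then 1 else 0 := by
  classical
  unfold expVec
  rw [Finsupp.finsetSum_apply, Finset.sum_eq_single e]
  · simp [Finsupp.single_apply]
  · intro e' _ h
    simp [Finsupp.single_apply, h]
  · simp

theorem expVec_le {E : Type} [Fintype E] {f g : E → Bool} (h : expVec f ≤ expVec g) :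
    f = g := by
  funext e
  have := h (e, f e)
  rw [expVec_apply, expVec_apply] at this
  by_contra hne
  have : g e ≠ f e := fun h => hne h.symm
  simp_all

theorem exists_cut (r : ℕ) (f : (SimpleGraph.pathGraph (r + 1)).edgeSet → Bool) :
    ∃ A : Finset (Fin (r + 1)), ∀ e, crossBool A e.1 = f e := by
  classical
  let F : ℕ → Bool := fun n => if h : n + 1 < r + 1 then
    f ⟨s(⟨n, by omega⟩, ⟨n + 1, h⟩), by simp [SimpleGraph.pathGraph_adj]⟩ else false
  obtain ⟨c, hc⟩ : ∃ c : ℕ → Bool, ∀ n, c (n + 1) = xor (c n) (F n) :=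
    ⟨fun n => Nat.rec (motive := fun _ => Bool) false (fun m b => xor b (F m)) n, fun n => rfl⟩
  obtain ⟨A, hA⟩ : ∃ A : Finset (Fin (r + 1)), ∀ i, i ∈ A ↔ c i.1 = true :=
    ⟨Finset.univ.filter (fun i : Fin (r + 1) => c i.1 = true), by simp⟩
  refine ⟨A, ?_⟩
  have key : ∀ (i j : Fin (r + 1)) (hij : s(i, j) ∈ (SimpleGraph.pathGraph (r + 1)).edgeSet),
      i.1 + 1 = j.1 → crossBool A s(i, j)
        = f ⟨s(i, j), hij⟩ := by
    intro i j hij h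
    obtain ⟨i, hi⟩ := i
    obtain ⟨j, hj⟩ := j
    simp only at h
    subst h
    have hF : F i = f ⟨s(⟨i, hi⟩, ⟨i + 1, hj⟩), hij⟩ := by
      simp only [F, hj, dif_pos]
    rw [← hF]
    simp [crossBool, hA, hc]
  rintro ⟨e, he⟩
  induction e using Sym2.ind with
  | _ i j =>
    have h := he
    rw [SimpleGraph.mem_edgeSet, SimpleGraph.pathGraph_adj] at h
    rcases h with h | h
    · exact key i j he h
    · have h2 := key j i (by rw [Sym2.eq_swap]; exact he) h
      simp only [Sym2.eq_swap (a := j) (b := i)] at h2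
      exact h2

theorem cutGen_eq (k : Type) [Field k] {V : Type} [DecidableEq V]
    (G : SimpleGraph V) [Fintype G.edgeSet] (h : ↑G.edgeSet.toFinset ⊆ G.edgeSet) (A : Finset V) :
    cutGen k G G.edgeSet.toFinset h A = monomial (expVec fun e => crossBool A e.1) 1 := by
  classical
  unfold cutGen expVec
  rw [monomial_sum_one]
  refine Finset.prod_bij (fun e _ => ⟨e.1, h e.2⟩) (by simp) ?_ ?_ ?_
  · intro a _ b _ hab
    exact Subtype.ext (Subtype.mk.inj hab)
  · intro b _
    exact ⟨⟨b.1, by simp⟩, by simp, rfl⟩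
  · intro a _
    rfl

theorem colon_eq (k : Type) [Field k] {E : Type} [Fintype E] (P : Set (E → Bool))
    (f : E → Bool) (hlow : ∀ g, g < f → g ∈ P) (hup : ∀ g ∈ P, ¬ f ≤ g) :
    Submodule.colon (Ideal.span ((fun d => monomial d (1 : k)) '' (expVec '' P)))
      (Ideal.span {monomial (expVec f) (1 : k)}) =
    Ideal.span ((fun v => (X v : MvPolynomial (E × Bool) k)) ''
      {v | v.2 = false ∧ f v.1 = true}) := by
  classical
  apply le_antisymm
  · intro h hh
    rw [Submodule.mem_colon] at hh
    have h1 := hh _ (Ideal.subset_span (Set.mem_singleton _))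
    rw [smul_eq_mul, mem_ideal_span_monomial_image] at h1
    rw [mem_ideal_span_X_image]
    intro m hm
    obtain ⟨_, ⟨g, hg, rfl⟩, hle⟩ := h1 (m + expVec f) (by
      rw [mem_support_iff, coeff_mul_monomial, mul_one]
      exact mem_support_iff.1 hm)
    have hn := hup g hg
    rw [Pi.le_def] at hn
    push Not at hn
    obtain ⟨e, he⟩ := hn
    have hfg : f e = true ∧ g e = false := by
      revert he
      cases f e <;> cases g e <;> simp
    refine ⟨(e, false), ⟨rfl, hfg.1⟩, ?_⟩
    have := hle (e, false)
    rw [Finsupp.add_apply, expVec_apply, expVec_apply, hfg.1, hfg.2] at this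
    simp at this
    omega
  · rw [Ideal.span_le]
    rintro _ ⟨⟨e, b⟩, ⟨hb, hf⟩, rfl⟩
    simp only at hb hf
    subst hb
    rw [SetLike.mem_coe, Submodule.mem_colon]
    intro q hq
    obtain ⟨a, rfl⟩ := Ideal.mem_span_singleton'.1 hq
    have hlt : Function.update f e false < f := by
      rw [update_lt_self_iff, hf]
      decide
    have hv : expVec f + Finsupp.single (e, false) 1
        = expVec (Function.update f e false) + Finsupp.single (e, true) 1 := by
      ext ⟨e', b⟩
      simp only [Finsupp.add_apply, expVec_apply, Finsupp.single_apply, Function.update_apply]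
      by_cases h : e' = e
      · subst h
        cases b <;> simp [hf]
      · have h' : ¬ e = e' := fun h2 => h h2.symm
        simp [h, h']
    have : (X (e, false) : MvPolynomial (E × Bool) k) • (a * monomial (expVec f) (1 : k))
        = (a * X (e, true)) * monomial (expVec (Function.update f e false)) 1 := by
      have h3 : (monomial (expVec f) (1 : k)) * X (e, false)
          = monomial (expVec (Function.update f e false)) 1 * X (e, true) := by
        rw [X, X, monomial_mul, monomial_mul, hv]
      rw [smul_eq_mul]
      linear_combination a * h3
    rw [this]
    exact Ideal.mul_mem_left _ _ (Ideal.subset_span ⟨_, ⟨_, hlow _ hlt, rfl⟩, rfl⟩)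

/-- For the path graph `T_r` (`r ≥ 1`), the monomial cut ideal `I(T_r)` has linear
quotients: there is an ordering `u_0, …, u_{ℓ-1}` of the minimal monomial generators of
`I(T_r)` (minimality being expressed by the fact that no generator divides another) such
that each colon ideal `(u_0, …, u_{p-1}) : u_p` is generated by a subset of the variables. -/
theorem monomial_cut_ideal_pathGraph_linearQuotients
    (k : Type) [Field k] (r : ℕ) (hr : 1 ≤ r)
    [DecidableRel (SimpleGraph.pathGraph (r + 1)).Adj]
    [Fintype (SimpleGraph.pathGraph (r + 1)).edgeSet] :
    ∃ (ℓ : ℕ)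
      (u : Fin ℓ → MvPolynomial (↥(SimpleGraph.pathGraph (r + 1)).edgeSet × Bool) k),
      (∀ i, ∃ d, u i = monomial d 1) ∧
      Ideal.span (Set.range u) = cutIdeal k (SimpleGraph.pathGraph (r + 1)) ∧
      (∀ i j, i ≠ j → ¬ u i ∣ u j) ∧
      (∀ p : Fin ℓ, 0 < (p : ℕ) →
        ∃ σ : Set (↥(SimpleGraph.pathGraph (r + 1)).edgeSet × Bool),
          Submodule.colon (Ideal.span {x | ∃ i, i < p ∧ x = u i}) (Ideal.span {u p}) =
            Ideal.span
              ((fun v => (X v : MvPolynomial (↥(SimpleGraph.pathGraph (r + 1)).edgeSet × Bool) k))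
                '' σ)) := by
  classical
  have : Fintype (LinearExtension (↥(SimpleGraph.pathGraph (r + 1)).edgeSet → Bool)) := inferInstanceAs (Fintype (↥(SimpleGraph.pathGraph (r + 1)).edgeSet → Bool))
  let o : Fin (Fintype.card (LinearExtension (↥(SimpleGraph.pathGraph (r + 1)).edgeSet → Bool))) ≃o LinearExtension (↥(SimpleGraph.pathGraph (r + 1)).edgeSet → Bool) :=
    Fintype.orderIsoFinOfCardEq _ rfl
  let w : Fin (Fintype.card (LinearExtension (↥(SimpleGraph.pathGraph (r + 1)).edgeSet → Bool))) → (↥(SimpleGraph.pathGraph (r + 1)).edgeSet → Bool) := fun i => o i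
  have winj : ∀ i j, w i = w j → i = j := fun i j h => o.injective h
  have wmono : ∀ i j, w i ≤ w j → i ≤ j := by
    intro i j h
    have h2 : o i ≤ o j := 
      (toLinearExtension (α := ↥(SimpleGraph.pathGraph (r + 1)).edgeSet → Bool)).monotone' h
    exact o.le_iff_le.1 h2
  have wsurj : ∀ f, ∃ i, w i = f := fun f => o.surjective f
  refine ⟨_, fun i => monomial (expVec (w i)) 1, fun i => ⟨_, rfl⟩, ?_, ?_, ?_⟩
  · unfold cutIdeal cutIdealOn
    congr 1
    ext x
    constructor
    · rintro ⟨i, rfl⟩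
      obtain ⟨A, hA⟩ := exists_cut r (w i)
      refine ⟨A, ?_⟩
      rw [cutGen_eq]
      simp only [hA]
    · rintro ⟨A, rfl⟩
      obtain ⟨i, hi⟩ := wsurj (fun e => crossBool A e.1)
      refine ⟨i, ?_⟩
      rw [cutGen_eq]
      simp only [hi]
  · intro i j hij hd
    rw [monomial_dvd_monomial] at hd
    rcases hd.1 with h | h
    · exact one_ne_zero h
    · exact hij (winj _ _ (expVec_le h))
  · intro p _
    have hset : {x | ∃ i, i < p ∧ x = monomial (expVec (w i)) (1 : k)}
        = (fun d => monomial d (1 : k)) '' (expVec '' (w '' {i | i < p})) := by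
      ext x
      constructor
      · rintro ⟨i, hi, rfl⟩
        exact ⟨_, ⟨_, ⟨i, hi, rfl⟩, rfl⟩, rfl⟩
      · rintro ⟨_, ⟨_, ⟨i, hi, rfl⟩, rfl⟩, rfl⟩
        exact ⟨i, hi, rfl⟩
    refine ⟨{v | v.2 = false ∧ w p v.1 = true}, ?_⟩
    rw [hset]
    apply colon_eq
    · intro g hg
      obtain ⟨i, rfl⟩ := wsurj g
      refine ⟨i, lt_of_le_of_ne (wmono _ _ hg.le) ?_, rfl⟩
      rintro rfl
      exact lt_irrefl _ hg
    · rintro _ ⟨i, hi, rfl⟩ hle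
      exact absurd (wmono _ _ hle) (not_le.2 hi)
end

section
/- Let G be a tree (a finite simple connected acyclic graph). Then for all 0 ≤ i ≤ |E(G)|, the i-th Betti number of the monomial cut ideal I(G) over S, namely β_i(I(G)) = dim_k Tor_i^S(I(G), k), equals 2^{|E(G)|−i} · binom(|E(G)|, i). -/
open MvPolynomial

open CategoryTheory

namespace CutBetti
open CategoryTheory.Limits CategoryTheory.MonoidalCategory

noncomputable section

variable {R : Type} [CommRing R] {N : ModuleCat.{0} R} (P : ProjectiveResolution N)

/-- The complex `M ⊗ P`. -/
def cpx : ModuleCat.{0} R ⥤ ChainComplex (ModuleCat.{0} R) ℕ where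
  obj M := (((tensoringLeft (ModuleCat.{0} R)).obj M).mapHomologicalComplex _).obj P.complex
  map f := (NatTrans.mapHomologicalComplex ((tensoringLeft (ModuleCat.{0} R)).map f) _).app P.complex

/-- Homology of `M ⊗ P`. -/
def hom (i : ℕ) : ModuleCat.{0} R ⥤ ModuleCat.{0} R :=
  cpx P ⋙ HomologicalComplex.homologyFunctor _ _ i

def torIso (M : ModuleCat.{0} R) (i : ℕ) :
    ((Tor (ModuleCat.{0} R) i).obj M).obj N ≅ (hom P i).obj M :=
  P.isoLeftDerivedObj ((tensoringLeft (ModuleCat.{0} R)).obj M) i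

instance : (cpx P).Additive where
  map_add {X Y f g} := by
    ext n : 1
    exact MonoidalPreadditive.add_whiskerRight f g

instance : (cpx P).Linear R where
  map_smul f r := by
    ext n : 1
    exact MonoidalLinear.smul_whiskerRight r f _

instance (i : ℕ) : (hom P i).Additive := by unfold hom; infer_instance

lemma homologyMap_smul' {C : Type*} [Category* C] [Abelian C] [Linear R C]
    {K L : ChainComplex C ℕ} (f : K ⟶ L) (r : R) (i : ℕ) :
    HomologicalComplex.homologyMap (r • f) i = r • HomologicalComplex.homologyMap f i := by
  have : (HomologicalComplex.shortComplexFunctor C _ i).map (r • f) =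
    r • (HomologicalComplex.shortComplexFunctor C _ i).map f := rfl
  unfold HomologicalComplex.homologyMap
  rw [this]
  exact ShortComplex.homologyMap_smul _ _

lemma hom_smul (i : ℕ) {X Y : ModuleCat.{0} R} (f : X ⟶ Y) (r : R) :
    (hom P i).map (r • f) = r • (hom P i).map f := by
  have : (cpx P).map (r • f) = r • (cpx P).map f := Functor.map_smul _ _ _
  change HomologicalComplex.homologyMap _ i = _
  rw [this]
  exact homologyMap_smul' _ _ _

lemma killed (i : ℕ) (M : ModuleCat.{0} R) (r : R) (hr : ∀ x : N, r • x = 0)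
    (y : (hom P i).obj M) : r • y = 0 := by
  have h0 : (r • 𝟙 P.complex) ≫ P.π = 0 := by
    have : r • 𝟙 N = 0 := by ext x; exact hr x
    have h2 : (r • 𝟙 P.complex) ≫ P.π = P.π ≫ (ChainComplex.single₀ _).map (r • 𝟙 N) := by
      refine HomologicalComplex.hom_ext _ _ ?_
      intro n
      rcases n with _ | n
      · have : ((ChainComplex.single₀ (ModuleCat R)).map (r • 𝟙 N)).f 0 = r • 𝟙 _ := by
          exact ChainComplex.single₀_map_f_zero _
        rw [HomologicalComplex.comp_f, HomologicalComplex.comp_f, this]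
        rw [HomologicalComplex.smul_f_apply, Linear.smul_comp, Linear.comp_smul,
          HomologicalComplex.id_f, Category.id_comp, Category.comp_id]
      · exact (HomologicalComplex.isZero_single_obj_X _ _ _ _ (by simp)).eq_of_tgt _ _
    rw [h2, this]; simp
  have H := ProjectiveResolution.liftHomotopyZero (r • 𝟙 P.complex) h0
  have H2 := ((tensoringLeft (ModuleCat.{0} R)).obj M).mapHomotopy H
  have e1 : (((tensoringLeft (ModuleCat.{0} R)).obj M).mapHomologicalComplex _).map (r • 𝟙 P.complex)
      = r • 𝟙 ((((tensoringLeft (ModuleCat.{0} R)).obj M).mapHomologicalComplex _).obj P.complex) := by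
    ext n : 1
    change M ◁ (r • 𝟙 (P.complex.X n)) = _
    rw [MonoidalLinear.whiskerLeft_smul]
    simp only [whiskerLeft_id, HomologicalComplex.smul_f_apply]
    rfl
  have H3 := H2.homologyMap_eq i
  rw [e1, homologyMap_smul', Functor.map_zero, HomologicalComplex.homologyMap_zero,
    HomologicalComplex.homologyMap_id] at H3
  have := congrArg (fun f => f.hom y) H3
  exact this


lemma cpx_shortExact (T : ShortComplex (ModuleCat.{0} R)) (hT : T.ShortExact) :
    (T.map (cpx P)).ShortExact := by
  apply HomologicalComplex.shortExact_of_degreewise_shortExact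
  intro n
  have hpr : Module.Projective R (P.complex.X n) :=
    (IsProjective.iff_projective _).mpr (P.projective n)
  have hinj : Function.Injective T.f.hom := (ModuleCat.mono_iff_injective _).1 hT.mono_f
  have hsurj : Function.Surjective T.g.hom := (ModuleCat.epi_iff_surjective _).1 hT.epi_g
  have hex : Function.Exact T.f.hom T.g.hom :=
    (ShortComplex.ShortExact.moduleCat_exact_iff_function_exact _).1 hT.exact
  have h1 := Module.Flat.rTensor_preserves_injective_linearMap (M := P.complex.X n) _ hinj
  have h2 := LinearMap.rTensor_surjective (P.complex.X n) hsurj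
  have h3 := Module.Flat.rTensor_exact (P.complex.X n) hex
  exact
    { exact := (ShortComplex.ShortExact.moduleCat_exact_iff_function_exact
        ((T.map (cpx P)).map (HomologicalComplex.eval _ _ n))).2 h3
      mono_f := (ModuleCat.mono_iff_injective _).2 h1
      epi_g := (ModuleCat.epi_iff_surjective _).2 h2 }

lemma dim_ext (m : Ideal R) [m.IsMaximal] {A B C : Type} [AddCommGroup A] [AddCommGroup B]
    [AddCommGroup C] [Module R A] [Module R B] [Module R C] (f : A →ₗ[R] B) (g : B →ₗ[R] C)
    (hf : Function.Injective f) (hg : Function.Surjective g) (hfg : Function.Exact f g)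
    (hB : ∀ r ∈ m, ∀ x : B, r • x = 0) {a c : ℕ}
    (eA : Nonempty (A ≃ₗ[R] (Fin a → R ⧸ m))) (eC : Nonempty (C ≃ₗ[R] (Fin c → R ⧸ m))) :
    Nonempty (B ≃ₗ[R] (Fin (a + c) → R ⧸ m)) := by
  obtain ⟨eA⟩ := eA
  obtain ⟨eC⟩ := eC
  let _ : Field (R ⧸ m) := Ideal.Quotient.field m
  have htB : Module.IsTorsionBySet R B m := fun x r => hB r r.2 x
  let _ : Module (R ⧸ m) B := htB.module
  have : IsScalarTower R (R ⧸ m) B := htB.isScalarTower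
  have hsur : Function.Surjective (algebraMap R (R ⧸ m)) := Ideal.Quotient.mk_surjective
  let f' : (Fin a → R ⧸ m) →ₗ[R ⧸ m] B :=
    LinearMap.extendScalarsOfSurjective hsur (f ∘ₗ eA.symm.toLinearMap)
  let g' : B →ₗ[R ⧸ m] (Fin c → R ⧸ m) :=
    LinearMap.extendScalarsOfSurjective hsur (eC.toLinearMap ∘ₗ g)
  have hf' : Function.Injective f' := hf.comp eA.symm.injective
  have hg' : Function.Surjective g' := eC.surjective.comp hg
  have hfg' : Function.Exact f' g' := by
    intro y
    change eC (g y) = 0 ↔ _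
    rw [LinearEquiv.map_eq_zero_iff, hfg y]
    constructor
    · rintro ⟨x, rfl⟩; exact ⟨eA x, by change f (eA.symm (eA x)) = _; simp⟩
    · rintro ⟨x, rfl⟩; exact ⟨eA.symm x, rfl⟩
  obtain ⟨e, -⟩ := hfg'.splitSurjectiveEquiv hf' ⟨_, (g'.exists_rightInverse_of_surjective
    (LinearMap.range_eq_top.2 hg')).choose_spec⟩
  exact ⟨((e.trans (LinearEquiv.sumArrowLequivProdArrow _ _ _ _).symm).trans
    (LinearEquiv.funCongrLeft _ _ finSumFinEquiv.symm)).restrictScalars R⟩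

/-- Betti numbers. -/
def HasB (m : Ideal R) (M : ModuleCat.{0} R) (b : ℕ → ℕ) : Prop :=
  ∀ i, Nonempty ((hom P i).obj M ≃ₗ[R] (Fin (b i) → R ⧸ m))

lemma HasB.step {m : Ideal R} [m.IsMaximal] (hm : ∀ r ∈ m, ∀ x : N, r • x = 0)
    (T : ShortComplex (ModuleCat.{0} R)) (hT : T.ShortExact)
    (h0 : ∀ i, (hom P i).map T.f = 0) {b1 b2 : ℕ → ℕ}
    (h1 : HasB P m T.X₁ b1) (h2 : HasB P m T.X₂ b2) :
    HasB P m T.X₃ (fun i => b2 i + (match i with | 0 => 0 | j + 1 => b1 j)) := by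
  have hS := cpx_shortExact P T hT
  have hinj : ∀ i, Function.Injective ((hom P i).map T.g).hom := by
    intro i
    have := (ShortComplex.ShortExact.moduleCat_exact_iff_function_exact _).1 (hS.homology_exact₂ i)
    rw [injective_iff_map_eq_zero]
    intro x hx
    obtain ⟨y, rfl⟩ := (this x).1 hx
    exact congrArg (fun f => f.hom y) (h0 i)
  intro i
  rcases i with _ | j
  · have hsurj : Function.Surjective ((hom P 0).map T.g).hom := by
      have := hS.epi_g
      exact (ModuleCat.epi_iff_surjective _).1
        (HomologicalComplex.epi_homologyMap_of_epi_of_not_rel (T.map (cpx P)).g 0 (by simp))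
    exact dim_ext m ((hom P 0).map T.g).hom (0 : _ →ₗ[R] (Fin 0 → R ⧸ m)) (hinj 0)
      (fun x => ⟨0, Subsingleton.elim _ _⟩) (fun y => ⟨fun _ => hsurj y, fun _ => rfl⟩)
      (fun r hr x => killed P _ _ r (hm r hr) x) (h2 0) ⟨LinearEquiv.refl _ _⟩
  · have hr : (ComplexShape.down ℕ).Rel (j + 1) j := by simp
    have e3 := (ShortComplex.ShortExact.moduleCat_exact_iff_function_exact _).1
      (hS.homology_exact₃ (j+1) j hr)
    have e1 := (ShortComplex.ShortExact.moduleCat_exact_iff_function_exact _).1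
      (hS.homology_exact₁ (j+1) j hr)
    refine dim_ext m ((hom P (j+1)).map T.g).hom (hS.δ (j+1) j hr).hom (hinj _) ?_ e3
      (fun r hr x => killed P _ _ r (hm r hr) x) (h2 _) (h1 _)
    intro x
    exact (e1 x).1 (congrArg (fun f => f.hom x) (h0 j))

lemma HasB.prod {m : Ideal R} [m.IsMaximal] (hm : ∀ r ∈ m, ∀ x : N, r • x = 0)
    (M : Type) [AddCommGroup M] [Module R M] {b : ℕ → ℕ}
    (h : HasB P m (ModuleCat.of R M) b) :
    HasB P m (ModuleCat.of R (M × M)) (fun i => b i + b i) := by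
  intro i
  let f := ModuleCat.ofHom (LinearMap.inl R M M)
  let g := ModuleCat.ofHom (LinearMap.snd R M M)
  let r := ModuleCat.ofHom (LinearMap.fst R M M)
  let s := ModuleCat.ofHom (LinearMap.inr R M M)
  have a1 : f ≫ r = 𝟙 _ := by ext; rfl
  have a2 : s ≫ g = 𝟙 _ := by ext; rfl
  have a3 : f ≫ g = 0 := by ext; rfl
  have a4 : r ≫ f + g ≫ s = 𝟙 _ := by ext x <;> simp [f, g, r, s]
  have k1 : ∀ x, ((hom P i).map r).hom (((hom P i).map f).hom x) = x := by
    intro x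
    have := congrArg (fun f => ((hom P i).map f).hom x) a1
    simpa using this
  have k2 : ∀ x, ((hom P i).map g).hom (((hom P i).map s).hom x) = x := by
    intro x
    have := congrArg (fun f => ((hom P i).map f).hom x) a2
    simpa using this
  have k3 : ∀ x, ((hom P i).map g).hom (((hom P i).map f).hom x) = 0 := by
    intro x
    have := congrArg (fun f => ((hom P i).map f).hom x) a3
    simpa using this
  have k4 : ∀ x, ((hom P i).map f).hom (((hom P i).map r).hom x) +
      ((hom P i).map s).hom (((hom P i).map g).hom x) = x := by
    intro x
    have := congrArg (fun f => ((hom P i).map f).hom x) a4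
    simpa using this
  refine dim_ext m ((hom P i).map f).hom ((hom P i).map g).hom
    (Function.LeftInverse.injective k1) (Function.RightInverse.surjective k2) ?_
    (fun r hr x => killed P _ _ r (hm r hr) x) (h i) (h i)
  intro y
  constructor
  · intro hy
    have := k4 y
    rw [hy, map_zero, add_zero] at this
    exact ⟨_, this⟩
  · rintro ⟨x, rfl⟩; exact k3 x

lemma HasB.congr {m : Ideal R} {M M' : ModuleCat.{0} R} (e : M ≅ M') {b : ℕ → ℕ}
    (h : HasB P m M b) : HasB P m M' b := fun i =>
  ⟨((hom P i).mapIso e).symm.toLinearEquiv.trans (h i).some⟩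

lemma HasB.base {m : Ideal R} (e : N ≃ₗ[R] R ⧸ m) :
    HasB P m (ModuleCat.of R R) (fun i => if i = 0 then 1 else 0) := by
  have e1 : (cpx P).obj (ModuleCat.of R R) ≅ P.complex := 
    HomologicalComplex.Hom.isoOfComponents (fun n => λ_ (P.complex.X n)) (by
      intro i j _
      exact (leftUnitor_naturality (P.complex.d i j)).symm)
  intro i
  have e2 : (hom P i).obj (ModuleCat.of R R) ≅ P.complex.homology i :=
    (HomologicalComplex.homologyFunctor _ _ i).mapIso e1
  rcases i with _ | i
  · have e3 : P.complex.homology 0 ≅ N :=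
      asIso (HomologicalComplex.homologyMap P.π 0) ≪≫
        HomologicalComplex.singleObjHomologySelfIso _ 0 N
    exact ⟨(e2 ≪≫ e3).toLinearEquiv.trans (e.trans (LinearEquiv.funUnique (Fin 1) R (R ⧸ m)).symm)⟩
  · have : IsZero (P.complex.homology (i+1)) := (P.complex_exactAt_succ i).isZero_homology
    have := this.of_iso e2
    have := ModuleCat.subsingleton_of_isZero this
    have : Subsingleton (Fin ((fun i => if i = 0 then 1 else 0) (i + 1)) → R ⧸ m) := by
      simp only [Nat.add_eq_zero_iff, one_ne_zero, and_false, if_false]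
      infer_instance
    exact ⟨LinearEquiv.ofSubsingleton _ _⟩


lemma HasB.koszul [IsDomain R] {m : Ideal R} [m.IsMaximal] (hm : ∀ r ∈ m, ∀ x : N, r • x = 0)
    (I J : Ideal R) (s t : R) (hs : s ∈ m) (ht : t ∈ m) (ht0 : t ≠ 0)
    (hcol : ∀ x, t * x ∈ J → x ∈ J) (hdvd : ∀ a, t ∣ s * a → t ∣ a)
    (hI : ∀ x, x ∈ I ↔ ∃ a ∈ J, ∃ b ∈ J, x = s * a + t * b) {b : ℕ → ℕ}
    (h : HasB P m (ModuleCat.of R J) b) :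
    HasB P m (ModuleCat.of R I) (fun i => (b i + b i) + (match i with | 0 => 0 | j + 1 => b j)) := by
  let f : J →ₗ[R] J × J := t • LinearMap.inl R J J - s • LinearMap.inr R J J
  let g : J × J →ₗ[R] I :=
    { toFun := fun p => ⟨s * p.1 + t * p.2, (hI _).2 ⟨_, p.1.2, _, p.2.2, rfl⟩⟩
      map_add' := by
        intro p q; ext; simp; ring
      map_smul' := by
        intro r p; ext; simp; ring }
  have f1 : ∀ x, ((f x).1 : R) = t * x := by intro x; simp [f]
  have f2 : ∀ x, ((f x).2 : R) = - (s * x) := by intro x; simp [f]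
  have hgf : g ∘ₗ f = 0 := by
    ext x
    change s * ((f x).1 : R) + t * ((f x).2 : R) = 0
    rw [f1, f2]; ring
  let T : ShortComplex (ModuleCat.{0} R) :=
    ShortComplex.mk (ModuleCat.ofHom f) (ModuleCat.ofHom g) (by
      rw [← ModuleCat.ofHom_comp, hgf]; rfl)
  have hT : T.ShortExact :=
    { exact := by
        refine (ShortComplex.ShortExact.moduleCat_exact_iff_function_exact T).2 ?_
        intro y
        constructor
        · intro hy
          obtain ⟨⟨a, ha⟩, ⟨b, hb⟩⟩ := y
          have hy' : s * a + t * b = 0 := congrArg Subtype.val hy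
          obtain ⟨c, rfl⟩ := hdvd a ⟨-b, by linear_combination hy'⟩
          refine ⟨⟨c, hcol c ha⟩, ?_⟩
          have hb' : b = - (s * c) := by
            apply mul_left_cancel₀ ht0
            linear_combination hy'
          refine Prod.ext (Subtype.ext (f1 _)) (Subtype.ext ((f2 _).trans hb'.symm))
        · rintro ⟨x, rfl⟩
          exact congrArg (fun f => f x) hgf
      mono_f := by
        refine (ModuleCat.mono_iff_injective _).2 ?_
        intro x y hxy
        have h1 : (f x).1 = (f y).1 := congrArg Prod.fst hxy
        have h2 := congrArg Subtype.val h1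
        rw [f1, f1] at h2
        exact Subtype.ext (mul_left_cancel₀ ht0 h2)
      epi_g := by
        refine (ModuleCat.epi_iff_surjective _).2 ?_
        rintro ⟨x, hx⟩
        obtain ⟨a, ha, b, hb, hab⟩ := (hI x).1 hx
        exact ⟨(⟨a, ha⟩, ⟨b, hb⟩), Subtype.ext hab.symm⟩ }
  refine HasB.step P hm T hT ?_ h (HasB.prod P hm J h)
  intro i
  have : T.f = t • ModuleCat.ofHom (LinearMap.inl R J J) -
    s • ModuleCat.ofHom (LinearMap.inr R J J) := rfl
  rw [this, Functor.map_sub, hom_smul, hom_smul]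
  have k : ∀ r ∈ m, ∀ φ : (hom P i).obj (ModuleCat.of R J) ⟶ (hom P i).obj (ModuleCat.of R (J × J)),
      r • φ = 0 := by
    intro r hr φ
    ext x
    exact killed P i _ r (hm r hr) _
  rw [k t ht, k s hs, sub_zero]

section poly
variable (k : Type) [Field k] {E : Type}
open Classical

/-- Generator attached to a choice of sides on the edges in `F`. -/
def gen (F : Finset E) (c : E → Bool) : MvPolynomial (E × Bool) k := ∏ e ∈ F, X (e, c e)

/-- The product of the ideals `(s_e, t_e)` over `e ∈ F`. -/
def JJ (F : Finset E) : Ideal (MvPolynomial (E × Bool) k) := Ideal.span (Set.range (gen k F))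

/-- Exponent of `gen`. -/
def expo (F : Finset E) (c : E → Bool) : (E × Bool) →₀ ℕ := ∑ e ∈ F, Finsupp.single (e, c e) 1

lemma gen_eq (F : Finset E) (c : E → Bool) : gen k F c = monomial (expo F c) 1 := by
  unfold gen expo
  rw [monomial_sum_one]
  rfl

lemma expo_notMem (F : Finset E) (c : E → Bool) (e : E) (he : e ∉ F) (b : Bool) :
    expo F c (e, b) = 0 := by
  unfold expo
  rw [Finsupp.finsetSum_apply]
  refine Finset.sum_eq_zero fun x hx => ?_
  rw [Finsupp.single_apply, if_neg]
  rintro h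
  simp only [Prod.mk.injEq] at h
  exact he (h.1 ▸ hx)

lemma mem_JJ (F : Finset E) (x : MvPolynomial (E × Bool) k) :
    x ∈ JJ k F ↔ ∀ a ∈ x.support, ∃ c, expo F c ≤ a := by
  have : Set.range (gen k F) = (fun s => monomial s (1 : k)) '' Set.range (expo F) := by
    rw [← Set.range_comp]
    congr 1
    ext1 c
    exact gen_eq k F c
  unfold JJ
  rw [this, mem_ideal_span_monomial_image]
  simp

lemma JJ_colon (F : Finset E) (e : E) (he : e ∉ F) (b : Bool) (x : MvPolynomial (E × Bool) k)
    (hx : X (e, b) * x ∈ JJ k F) : x ∈ JJ k F := by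
  rw [mem_JJ] at hx ⊢
  intro a ha
  obtain ⟨c, hc⟩ := hx (Finsupp.single (e, b) 1 + a) (by
    rw [mem_support_iff, coeff_X_mul]; exact mem_support_iff.1 ha)
  refine ⟨c, fun p => ?_⟩
  by_cases hp : p = (e, b)
  · subst hp; rw [expo_notMem F c e he]; exact Nat.zero_le _
  · have := hc p
    rwa [Finsupp.add_apply, Finsupp.single_apply, if_neg (Ne.symm hp), zero_add] at this

lemma JJ_insert (F : Finset E) (e : E) (he : e ∉ F) (x : MvPolynomial (E × Bool) k) :
    x ∈ JJ k (insert e F) ↔ ∃ a ∈ JJ k F, ∃ b ∈ JJ k F, x = X (e, true) * a + X (e, false) * b := by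
  have hg : ∀ c, gen k (insert e F) c = X (e, c e) * gen k F c := fun c => Finset.prod_insert he
  have hup : ∀ c b, gen k F (Function.update c e b) = gen k F c := by
    intro c b
    refine Finset.prod_congr rfl fun y hy => ?_
    rw [Function.update_of_ne]
    rintro rfl; exact he hy
  constructor
  · intro hx
    refine Submodule.span_induction ?_ ?_ ?_ ?_ hx
    · rintro _ ⟨c, rfl⟩
      have hm : gen k F c ∈ JJ k F := Ideal.subset_span ⟨c, rfl⟩
      rw [hg]
      cases c e
      · exact ⟨0, zero_mem _, _, hm, by ring⟩
      · exact ⟨_, hm, 0, zero_mem _, by ring⟩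
    · exact ⟨0, zero_mem _, 0, zero_mem _, by ring⟩
    · rintro _ _ _ _ ⟨a, ha, b, hb, rfl⟩ ⟨a', ha', b', hb', rfl⟩
      exact ⟨_, add_mem ha ha', _, add_mem hb hb', by ring⟩
    · rintro r _ _ ⟨a, ha, b, hb, rfl⟩
      exact ⟨_, Ideal.mul_mem_left _ r ha, _, Ideal.mul_mem_left _ r hb, by rw [smul_eq_mul]; ring⟩
  · have key : ∀ v, ∀ a ∈ JJ k F, X (e, v) * a ∈ JJ k (insert e F) := by
      intro v a ha
      refine Submodule.span_induction ?_ ?_ ?_ ?_ ha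
      · rintro _ ⟨c, rfl⟩
        refine Ideal.subset_span ⟨Function.update c e v, ?_⟩
        rw [hg, hup, Function.update_self]
      · rw [mul_zero]; exact zero_mem _
      · intro x y _ _ hx hy; rw [mul_add]; exact add_mem hx hy
      · intro r x _ hx
        rw [smul_eq_mul, mul_left_comm]; exact Ideal.mul_mem_left _ r hx
    rintro ⟨a, ha, b, hb, rfl⟩
    exact add_mem (key _ _ ha) (key _ _ hb)

lemma betti_rec (n i : ℕ) :
    (2 ^ (n + 1 - i) * (n + 1).choose i) = (2 ^ (n - i) * n.choose i + 2 ^ (n - i) * n.choose i) +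
      (match i with | 0 => 0 | j + 1 => 2 ^ (n - j) * n.choose j) := by
  rcases i with _ | j
  · simp [pow_succ]; ring
  · simp only [Nat.add_sub_add_right, Nat.choose_succ_succ]
    rcases lt_or_ge j n with h | h
    · obtain ⟨d, rfl⟩ := Nat.exists_eq_add_of_lt h
      have h1 : j + d + 1 - j = d + 1 := by omega
      have h2 : j + d + 1 - (j + 1) = d := by omega
      rw [h1, h2, pow_succ]; ring
    · rw [Nat.choose_eq_zero_of_lt (show n < j + 1 by omega)]; ring

lemma HasB.ofJJ {N : ModuleCat.{0} (MvPolynomial (E × Bool) k)} (P : ProjectiveResolution N)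
    (m : Ideal (MvPolynomial (E × Bool) k)) [m.IsMaximal] (hX : ∀ v, X v ∈ m)
    (e : N ≃ₗ[MvPolynomial (E × Bool) k] MvPolynomial (E × Bool) k ⧸ m) (F : Finset E) :
    HasB P m (ModuleCat.of _ (JJ k F)) (fun i => 2 ^ (F.card - i) * F.card.choose i) := by
  have hm : ∀ r ∈ m, ∀ x : N, r • x = 0 := by
    intro r hr x
    apply e.injective
    rw [map_smul, map_zero]
    obtain ⟨y, hy⟩ := Submodule.Quotient.mk_surjective _ (e x)
    rw [← hy, ← Submodule.Quotient.mk_smul, Submodule.Quotient.mk_eq_zero]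
    exact Ideal.mul_mem_right _ _ hr
  induction F using Finset.induction_on with
  | empty =>
    have h1 : JJ k (∅ : Finset E) = ⊤ := by
      rw [Ideal.eq_top_iff_one]
      exact Ideal.subset_span ⟨fun _ => true, by simp [gen]⟩
    have := HasB.congr P (LinearEquiv.toModuleIso
      ((LinearEquiv.ofTop (JJ k (∅ : Finset E)) h1).symm)) (HasB.base P e)
    convert this using 2 with i
    rcases i with _ | i <;> simp
  | insert a F ha ih =>
    have := HasB.koszul P hm (JJ k (insert a F)) (JJ k F) (X (a, true)) (X (a, false))
      (hX _) (hX _) (X_ne_zero _) (JJ_colon k F a ha _) (by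
        intro y hy
        refine ((X_prime (R := k) (i := (a, false))).dvd_or_dvd hy).resolve_left ?_
        rw [X_dvd_X]; simp) (JJ_insert k F a ha) ih
    rw [Finset.card_insert_of_notMem ha]
    convert this using 2 with i
    exact betti_rec _ i

end poly

lemma maximal_X (k σ : Type) [Field k] :
    (Ideal.span (Set.range (X : σ → MvPolynomial σ k))).IsMaximal := by
  have : Ideal.span (Set.range (X : σ → MvPolynomial σ k)) =
      RingHom.ker (constantCoeff : MvPolynomial σ k →+* k) := by
    ext x
    rw [← Set.image_univ, mem_ideal_span_X_image, RingHom.mem_ker, constantCoeff_eq]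
    constructor
    · intro h
      by_contra h0
      obtain ⟨i, -, hi⟩ := h 0 (mem_support_iff.2 h0)
      exact hi rfl
    · intro h m hm
      by_contra! h0
      have : m = 0 := Finsupp.ext fun i => h0 i trivial
      subst this
      exact mem_support_iff.1 hm h
  rw [this]
  exact RingHom.ker_isMaximal_of_surjective _ (fun x => ⟨C x, by simp⟩)

lemma realize {V : Type} [Fintype V] [DecidableEq V] (G : SimpleGraph V) (hG : G.IsAcyclic)
    [Fintype G.edgeSet]
    (c : G.edgeSet → Bool) : ∃ A : Finset V, ∀ e : G.edgeSet, crossBool A e.1 = c e := by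
  classical
  have h1 : ∀ e : G.edgeSet, ∃ f : V → ZMod 2, ∀ i j, (h : s(i, j) ∈ G.edgeSet) →
      f i + f j = if (⟨s(i, j), h⟩ : G.edgeSet) = e then 1 else 0 := by
    rintro ⟨e, he⟩
    have hb := SimpleGraph.isAcyclic_iff_forall_isBridge.1 hG he
    induction e using Sym2.ind with | _ u v =>
    rw [SimpleGraph.isBridge_iff] at hb
    refine ⟨fun w => if (G.deleteEdges {s(u, v)}).Reachable u w then 1 else 0, ?_⟩
    intro i j h
    simp only [Subtype.mk.injEq]
    have hu : (G.deleteEdges {s(u, v)}).Reachable u u := SimpleGraph.Reachable.refl _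
    by_cases h1 : s(i, j) = s(u, v)
    · rw [if_pos h1]
      rcases Sym2.eq_iff.1 h1 with ⟨rfl, rfl⟩ | ⟨rfl, rfl⟩
      · rw [if_pos hu, if_neg hb]; rfl
      · rw [if_pos hu, if_neg hb]; rfl
    · rw [if_neg h1]
      have ha : (G.deleteEdges {s(u, v)}).Adj i j := by
        rw [SimpleGraph.deleteEdges_adj]; exact ⟨(G.mem_edgeSet).1 h, h1⟩
      by_cases h2 : (G.deleteEdges {s(u, v)}).Reachable u i
      · rw [if_pos h2, if_pos (h2.trans ha.reachable)]; rfl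
      · rw [if_neg h2, if_neg (fun h3 => h2 (h3.trans ha.symm.reachable))]; rfl
  choose f hf using h1
  let p : V → ZMod 2 := fun v => ∑ e, if c e then f e v else 0
  refine ⟨Finset.univ.filter fun v => p v = 1, ?_⟩
  rintro ⟨e, he⟩
  induction e using Sym2.ind with | _ u v =>
  have hp : p u + p v = if c ⟨s(u, v), he⟩ then 1 else 0 := by
    simp only [p]
    rw [← Finset.sum_add_distrib, Finset.sum_eq_single ⟨s(u, v), he⟩]
    · have := hf ⟨s(u, v), he⟩ u v he
      split_ifs with h
      · rw [this]; simp
      · simp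
    · intro b _ hb
      have := hf b u v he
      rw [if_neg (Ne.symm hb)] at this
      split_ifs <;> simp [this]
    · simp
  have z : ∀ a b : ZMod 2, ∀ t : Bool, (a + b = if t then 1 else 0) →
      xor (decide (a = 1)) (decide (b = 1)) = t := by decide
  change xor (decide (u ∈ _)) (decide (v ∈ _)) = _
  simp only [Finset.mem_filter, Finset.mem_univ, true_and]
  exact z _ _ _ hp

lemma cutIdeal_eq (k : Type) [Field k] {V : Type} [Fintype V] [DecidableEq V]
    (G : SimpleGraph V) (hG : G.IsAcyclic) [Fintype G.edgeSet] :
    cutIdeal k G = JJ k (Finset.univ : Finset G.edgeSet) := by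
  have hg : ∀ A, cutGen k G G.edgeSet.toFinset (by simp) A =
      gen k Finset.univ (fun e : G.edgeSet => crossBool A e.1) := by
    intro A
    unfold cutGen gen
    refine Finset.prod_bij (fun e _ => ⟨e.1, Set.mem_toFinset.1 e.2⟩) ?_ ?_ ?_ ?_
    · simp
    · intro a _ b _ h
      exact Subtype.ext (Subtype.mk.inj h)
    · intro b _
      exact ⟨⟨b.1, by simp⟩, by simp, rfl⟩
    · intro a _; rfl
  unfold cutIdeal cutIdealOn JJ
  congr 1
  ext x
  constructor
  · rintro ⟨A, rfl⟩; exact ⟨_, (hg A).symm⟩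
  · rintro ⟨c, rfl⟩
    obtain ⟨A, hA⟩ := realize G hG c
    exact ⟨A, (hg A).trans (congrArg _ (funext hA))⟩

end
end CutBetti

/-- For a tree `G`, the `i`-th Betti number of `I(G)` over `S` equals
`2^(|E(G)| - i) * |E(G)|.choose i` for `0 ≤ i ≤ |E(G)|`; the statement
`dim_k Tor_i^S(I(G), k) = β` is expressed by the existence of an `S`-linear isomorphism
`Tor_i^S(I(G), S/𝔪) ≃ (S/𝔪)^β`, where `𝔪 = (X_v : v)` is the irrelevant maximal ideal,
so that `S/𝔪 ≅ k`. -/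
theorem monomial_cut_ideal_tree_betti_numbers
    (k : Type) [Field k] {V : Type} [Fintype V] [DecidableEq V]
    (G : SimpleGraph V) [DecidableRel G.Adj] (hG : G.IsTree)
    (i : ℕ) (hi : i ≤ Fintype.card ↥G.edgeSet) :
    Nonempty
      ((((Tor (ModuleCat (MvPolynomial (↥G.edgeSet × Bool) k)) i).obj
            (ModuleCat.of (MvPolynomial (↥G.edgeSet × Bool) k) ↥(cutIdeal k G))).obj
          (ModuleCat.of (MvPolynomial (↥G.edgeSet × Bool) k)
            (MvPolynomial (↥G.edgeSet × Bool) k ⧸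
              Ideal.span (Set.range (X : ↥G.edgeSet × Bool → MvPolynomial (↥G.edgeSet × Bool) k)))))
        ≃ₗ[MvPolynomial (↥G.edgeSet × Bool) k]
      (Fin (2 ^ (Fintype.card ↥G.edgeSet - i) * (Fintype.card ↥G.edgeSet).choose i) →
        MvPolynomial (↥G.edgeSet × Bool) k ⧸
          Ideal.span (Set.range (X : ↥G.edgeSet × Bool → MvPolynomial (↥G.edgeSet × Bool) k)))) := by
  have hmax := CutBetti.maximal_X k (↥G.edgeSet × Bool)
  rw [CutBetti.cutIdeal_eq k G hG.2]
  let P := ProjectiveResolution.of (ModuleCat.of (MvPolynomial (↥G.edgeSet × Bool) k)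
            (MvPolynomial (↥G.edgeSet × Bool) k ⧸
              Ideal.span (Set.range (X : ↥G.edgeSet × Bool → MvPolynomial (↥G.edgeSet × Bool) k))))
  obtain ⟨e⟩ := CutBetti.HasB.ofJJ k P _ (fun v => Ideal.subset_span (Set.mem_range_self v))
    (LinearEquiv.refl _ _) (Finset.univ : Finset G.edgeSet) i
  exact ⟨(CutBetti.torIso P _ i).toLinearEquiv.trans e⟩
end

section
/- Let C_r be the cycle on vertices {1,…,r} with edges {i,i+1} for 1 ≤ i ≤ r (indices modulo r), where r ≥ 3. Then the minimal primes of S/I(C_r) of height 2 are exactly the ideals (s_{i,i+1}, t_{i,i+1}) for the edges {i,i+1} of C_r. -/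
open MvPolynomial

namespace CutAux

open Classical in
theorem isPrime_span_X {σ : Type} {k : Type} [Field k] (s : Set σ) :
    (Ideal.span (X '' s : Set (MvPolynomial σ k))).IsPrime := by
  let φ : MvPolynomial σ k →ₐ[k] MvPolynomial σ k :=
    aeval (fun i => if i ∈ s then 0 else X i)
  have h : Ideal.span (X '' s : Set (MvPolynomial σ k)) = RingHom.ker φ := by
    apply le_antisymm
    · rw [Ideal.span_le]
      rintro _ ⟨i, hi, rfl⟩
      simp [φ, RingHom.mem_ker, hi]
    · intro f hf
      have key : (Ideal.Quotient.mkₐ k (Ideal.span (X '' s : Set (MvPolynomial σ k)))).comp φ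
          = Ideal.Quotient.mkₐ k (Ideal.span (X '' s : Set (MvPolynomial σ k))) := by
        apply MvPolynomial.algHom_ext
        intro i
        by_cases hi : i ∈ s
        · have : (X i : MvPolynomial σ k) ∈ Ideal.span (X '' s : Set (MvPolynomial σ k)) :=
            Ideal.subset_span ⟨i, hi, rfl⟩
          simp only [φ, AlgHom.comp_apply, aeval_X, hi, if_true, map_zero]
          exact (Ideal.Quotient.eq_zero_iff_mem.2 this).symm
        · simp [φ, hi]
      have h2 := DFunLike.congr_fun key f
      have hf' : φ f = 0 := hf
      rw [AlgHom.comp_apply, hf', map_zero] at h2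
      exact Ideal.Quotient.eq_zero_iff_mem.1 h2.symm
  rw [h]
  exact RingHom.ker_isPrime _

theorem X_mem_span_iff {σ : Type} {k : Type} [Field k] (s : Set σ) (i : σ) :
    (X i : MvPolynomial σ k) ∈ Ideal.span (X '' s : Set (MvPolynomial σ k)) ↔ i ∈ s := by
  constructor
  · intro h
    rw [mem_ideal_span_X_image] at h
    obtain ⟨j, hj, hne⟩ := h (Finsupp.single i 1) (by simp [mem_support_iff, coeff_X])
    by_cases hij : i = j
    · exact hij ▸ hj
    · simp [Finsupp.single_apply, hij] at hne
  · intro h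
    exact Ideal.subset_span ⟨i, h, rfl⟩

theorem card_le_height {σ : Type} {k : Type} [Field k] [DecidableEq σ] (s : Finset σ) :
    (s.card : ℕ∞) ≤ (Ideal.span (X '' (s : Set σ) : Set (MvPolynomial σ k))).height := by
  induction s using Finset.induction_on with
  | empty => simp
  | insert a s ha ih =>
    have := isPrime_span_X (k := k) (s : Set σ)
    have := isPrime_span_X (k := k) ((insert a s : Finset σ) : Set σ)
    rw [Finset.card_insert_of_notMem ha]
    rw [Nat.cast_add, Nat.cast_one]
    refine le_trans (add_le_add_left ih 1) (Ideal.height_add_one_le_of_lt_of_isPrime ?_)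
    refine lt_of_le_of_ne (Ideal.span_mono (Set.image_mono (by simp))) ?_
    intro h
    apply ha
    have h2 := (X_mem_span_iff (k := k) (s : Set σ) a).1
    rw [h] at h2
    exact h2 ((X_mem_span_iff _ a).2 (by simp))

theorem exists_cut {V : Type} [DecidableEq V] (e f : Sym2 V) (he : ¬ e.IsDiag)
    (hf : ¬ f.IsDiag) (h : e ≠ f) (a b : Bool) :
    ∃ A : Finset V, crossBool A e = a ∧ crossBool A f = b := by
  have key : ∀ x u y v : V, x ≠ u → y ≠ v → x ≠ y → x ≠ v → y ≠ u →
      ∃ A : Finset V, crossBool A s(x, u) = a ∧ crossBool A s(y, v) = b := by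
    intro x u y v h1 h2 h3 h4 h5
    refine ⟨(if a then {x} else ∅) ∪ (if b then {y} else ∅), ?_, ?_⟩ <;>
    cases a <;> cases b <;>
      simp [crossBool, h1, h2, h3, h4, h5, h1.symm, h2.symm, h3.symm, h4.symm, h5.symm]
  induction e using Sym2.ind with | _ x u =>
  induction f using Sym2.ind with | _ y v =>
  simp only [Sym2.mk_isDiag_iff] at he hf
  have hs1 : s(x, u) = s(u, x) := Sym2.eq_swap
  have hs2 : s(y, v) = s(v, y) := Sym2.eq_swap
  rw [Ne, Sym2.eq_iff] at h
  by_cases hx : x = y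
  · subst hx
    rw [hs1, hs2]
    apply key <;> grind
  by_cases hx' : x = v
  · subst hx'
    rw [hs1]
    apply key <;> grind
  by_cases hy : u = y
  · subst hy
    rw [hs2]
    apply key <;> grind
  · apply key <;> grind

theorem exists_cut_one {V : Type} [DecidableEq V] (e : Sym2 V) (he : ¬ e.IsDiag) (a : Bool) :
    ∃ A : Finset V, crossBool A e = a := by
  induction e using Sym2.ind with | _ x u =>
  simp only [Sym2.mk_isDiag_iff] at he
  refine ⟨if a then {x} else ∅, ?_⟩
  cases a <;> simp [crossBool, Ne.symm he]

theorem exists_mem {k : Type} [Field k] {V : Type} [DecidableEq V] (G : SimpleGraph V)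
    [Fintype G.edgeSet] (p : Ideal (MvPolynomial (↥G.edgeSet × Bool) k)) (hp : p.IsPrime)
    (hI : cutIdeal k G ≤ p) (A : Finset V) :
    ∃ e : G.edgeSet, X (e, crossBool A e.1) ∈ p := by
  have h : cutGen k G G.edgeSet.toFinset (by simp) A ∈ p := hI (Ideal.subset_span ⟨A, rfl⟩)
  rw [cutGen, hp.prod_mem_iff] at h
  obtain ⟨e, -, he⟩ := h
  exact ⟨_, he⟩

theorem le_span {k : Type} [Field k] {V : Type} [DecidableEq V] (G : SimpleGraph V)
    [Fintype G.edgeSet] (e : G.edgeSet) :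
    cutIdeal k G ≤ Ideal.span (X '' ({(e, true), (e, false)} : Set (↥G.edgeSet × Bool))) := by
  unfold cutIdeal cutIdealOn
  rw [Ideal.span_le]
  rintro _ ⟨A, rfl⟩
  have hp := isPrime_span_X (k := k) ({(e, true), (e, false)} : Set (↥G.edgeSet × Bool))
  rw [SetLike.mem_coe, cutGen, hp.prod_mem_iff]
  refine ⟨⟨e.1, by simp⟩, Finset.mem_attach _ _, ?_⟩
  rw [X_mem_span_iff]
  cases h : crossBool A e.1 <;> simp [h]

theorem main {k : Type} [Field k] {V : Type} [DecidableEq V] (G : SimpleGraph V)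
    [Fintype G.edgeSet] (p : Ideal (MvPolynomial (↥G.edgeSet × Bool) k)) :
    (p ∈ (cutIdeal k G).minimalPrimes ∧ ∃ hp : p.IsPrime,
      Order.height (⟨p, hp⟩ : PrimeSpectrum (MvPolynomial (↥G.edgeSet × Bool) k)) = 2) ↔
    ∃ e : G.edgeSet,
      Ideal.span (X '' ({(e, true), (e, false)} : Set (↥G.edgeSet × Bool))) = p := by
  classical
  have hd : ∀ e : G.edgeSet, ¬ e.1.IsDiag := fun e => G.not_isDiag_of_mem_edgeSet e.2
  constructor
  · rintro ⟨hmin, hp, hht⟩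
    have hI := hmin.1.2
    rw [← PrimeSpectrum.height_eq_orderHeight] at hht
    by_cases hex : ∃ e : G.edgeSet, X (e, true) ∈ p ∧ X (e, false) ∈ p
    · obtain ⟨e, h1, h2⟩ := hex
      have hle : Ideal.span (X '' ({(e, true), (e, false)} : Set (↥G.edgeSet × Bool))) ≤ p := by
        rw [Ideal.span_le]
        rintro _ ⟨i, (rfl | rfl), rfl⟩
        · exact h1
        · exact h2
      exact ⟨e, le_antisymm hle (hmin.2 ⟨isPrime_span_X _, le_span G e⟩ hle)⟩
    · exfalso
      have hno : ∀ e : G.edgeSet, ∀ a b : Bool, X (e, a) ∈ p → X (e, b) ∈ p → a = b := by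
        intro e a b h1 h2
        by_contra hab
        apply hex
        refine ⟨e, ?_⟩
        cases a <;> cases b <;> simp_all
      obtain ⟨e₁, h₁⟩ := exists_mem G p hp hI ∅
      generalize crossBool ∅ e₁.1 = a at h₁
      obtain ⟨A, hA⟩ := exists_cut_one e₁.1 (hd e₁) (!a)
      obtain ⟨e₂, h₂⟩ := exists_mem G p hp hI A
      have h12 : e₁ ≠ e₂ := by
        rintro rfl
        rw [hA] at h₂
        have := hno _ _ _ h₁ h₂
        simp at this
      generalize crossBool A e₂.1 = b at h₂
      obtain ⟨B, hB1, hB2⟩ := exists_cut e₁.1 e₂.1 (hd e₁) (hd e₂)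
        (fun h => h12 (Subtype.ext h)) (!a) (!b)
      obtain ⟨e₃, h₃⟩ := exists_mem G p hp hI B
      have h13 : e₁ ≠ e₃ := by
        rintro rfl
        rw [hB1] at h₃
        have := hno _ _ _ h₁ h₃
        simp at this
      have h23 : e₂ ≠ e₃ := by
        rintro rfl
        rw [hB2] at h₃
        have := hno _ _ _ h₂ h₃
        simp at this
      generalize crossBool B e₃.1 = c at h₃
      have hc := card_le_height (k := k)
        ({(e₁, a), (e₂, b), (e₃, c)} : Finset (↥G.edgeSet × Bool))
      have hcard : ({(e₁, a), (e₂, b), (e₃, c)} : Finset (↥G.edgeSet × Bool)).card = 3 := by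
        rw [Finset.card_eq_three]
        exact ⟨_, _, _, by simp [h12], by simp [h13], by simp [h23], rfl⟩
      rw [hcard] at hc
      have hle : Ideal.span (X '' ((({(e₁, a), (e₂, b), (e₃, c)} :
          Finset (↥G.edgeSet × Bool))) : Set (↥G.edgeSet × Bool))) ≤ p := by
        rw [Ideal.span_le]
        rintro _ ⟨i, hi, rfl⟩
        simp only [Finset.coe_insert, Finset.coe_singleton, Set.mem_insert_iff,
          Set.mem_singleton_iff] at hi
        rcases hi with rfl | rfl | rfl <;> assumption
      have := hc.trans (Ideal.height_mono hle)
      rw [hht] at this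
      exact absurd this (by decide)
  · rintro ⟨e, rfl⟩
    have hp := isPrime_span_X (k := k) ({(e, true), (e, false)} : Set (↥G.edgeSet × Bool))
    refine ⟨⟨⟨hp, le_span G e⟩, ?_⟩, hp, ?_⟩
    · rintro q ⟨hq, hIq⟩ hle
      have hall : ∀ a : Bool, X (e, a) ∈ q := by
        intro a
        obtain ⟨A, hA⟩ := exists_cut_one e.1 (hd e) a
        obtain ⟨f, hf⟩ := exists_mem G q hq hIq A
        have h := (X_mem_span_iff _ _).1 (hle hf)
        have hfe : f = e := by
          simp only [Set.mem_insert_iff, Set.mem_singleton_iff, Prod.mk.injEq] at h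
          tauto
        subst hfe
        rwa [hA] at hf
      rw [Ideal.span_le]
      rintro _ ⟨i, (rfl | rfl), rfl⟩ <;> exact hall _
    · rw [← PrimeSpectrum.height_eq_orderHeight]
      apply le_antisymm
      · have hfin : (X '' ({(e, true), (e, false)} : Set (↥G.edgeSet × Bool)) :
            Set (MvPolynomial (↥G.edgeSet × Bool) k)).Finite := Set.toFinite _
        have h1 := Ideal.height_le_card_of_mem_minimalPrimes_span hfin
          (p := Ideal.span (X '' ({(e, true), (e, false)} : Set (↥G.edgeSet × Bool))))
          (by rw [Ideal.minimalPrimes_eq_subsingleton_self]; rfl)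
        refine h1.trans ?_
        have h2 := Set.ncard_image_le (f := (X : _ → MvPolynomial (↥G.edgeSet × Bool) k))
          (Set.toFinite ({(e, true), (e, false)} : Set (↥G.edgeSet × Bool)))
        rw [Set.ncard_pair (by simp)] at h2
        exact_mod_cast h2
      · have hc := card_le_height (k := k) ({(e, true), (e, false)} : Finset (↥G.edgeSet × Bool))
        rw [Finset.card_pair (by simp)] at hc
        simpa using hc

end CutAux

/-- For the cycle `C_r` (`r ≥ 3`), the minimal primes of `S/I(C_r)` of height 2 are
exactly the ideals `(s_{i,i+1}, t_{i,i+1})` for the edges of `C_r`.  The height of a prime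
ideal `p` is the height of the corresponding point of the prime spectrum. -/
theorem monomial_cut_ideal_cycle_minimal_primes_height_two
    (k : Type) [Field k] (r : ℕ) (hr : 3 ≤ r)
    [DecidableRel (SimpleGraph.cycleGraph r).Adj]
    [Fintype (SimpleGraph.cycleGraph r).edgeSet] :
    {p : Ideal (MvPolynomial (↥(SimpleGraph.cycleGraph r).edgeSet × Bool) k) |
        p ∈ (cutIdeal k (SimpleGraph.cycleGraph r)).minimalPrimes ∧
        ∃ hp : p.IsPrime,
          Order.height
            (⟨p, hp⟩ : PrimeSpectrum (MvPolynomial (↥(SimpleGraph.cycleGraph r).edgeSet × Bool) k))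
            = 2} =
      Set.range (fun e : ↥(SimpleGraph.cycleGraph r).edgeSet =>
        Ideal.span {X ((e, true) : ↥(SimpleGraph.cycleGraph r).edgeSet × Bool),
                    X ((e, false) : ↥(SimpleGraph.cycleGraph r).edgeSet × Bool)}) := by
  ext p
  have h := CutAux.main (k := k) (SimpleGraph.cycleGraph r) p
  simp only [Set.image_pair] at h
  exact h
end

section
/- Let C_r be the cycle on vertices {1,…,r} with edges {i,i+1} for 1 ≤ i ≤ r (indices modulo r), where r ≥ 3. If 𝔭 is a minimal prime of S/I(C_r) with height(𝔭) ≥ 3, then height(𝔭) = |E(C_r)| = r. -/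
open MvPolynomial

section helpers

/-- kill the variables in `s` -/
noncomputable def killVars (k : Type) [Field k] {σ : Type} (s : Set σ) :
    MvPolynomial σ k →ₐ[k] MvPolynomial σ k :=
  open Classical in aeval (fun x => if x ∈ s then 0 else X x)

lemma span_X_eq_ker (k : Type) [Field k] {σ : Type} (s : Set σ) :
    Ideal.span (Set.image (X : σ → MvPolynomial σ k) s) = RingHom.ker (killVars k s) := by
  classical
  apply le_antisymm
  · rw [Ideal.span_le]
    rintro _ ⟨x, hx, rfl⟩
    simp [RingHom.mem_ker, killVars, hx]
  · intro f hf
    have h : ((Ideal.Quotient.mk (Ideal.span (Set.image (X : σ → MvPolynomial σ k) s))).comp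
        (killVars k s : MvPolynomial σ k →+* MvPolynomial σ k))
        = Ideal.Quotient.mk (Ideal.span (Set.image (X : σ → MvPolynomial σ k) s)) := by
      apply MvPolynomial.ringHom_ext
      · intro c
        simp [killVars]
      · intro x
        by_cases hx : x ∈ s
        · have : (X x : MvPolynomial σ k) ∈ Ideal.span (Set.image (X : σ → MvPolynomial σ k) s) :=
            Ideal.subset_span ⟨x, hx, rfl⟩
          simp [killVars, hx, Ideal.Quotient.eq_zero_iff_mem.2 this]
        · simp [killVars, hx]
    have h2 := RingHom.congr_fun h f
    rw [RingHom.mem_ker] at hf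
    have h3 : (killVars k s : MvPolynomial σ k →+* MvPolynomial σ k) f = 0 := hf
    rw [RingHom.comp_apply, h3, map_zero] at h2
    exact Ideal.Quotient.eq_zero_iff_mem.1 h2.symm

lemma span_X_prime (k : Type) [Field k] {σ : Type} (s : Set σ) :
    (Ideal.span (Set.image (X : σ → MvPolynomial σ k) s)).IsPrime := by
  rw [span_X_eq_ker]
  exact RingHom.ker_isPrime _

lemma X_mem_span_X (k : Type) [Field k] {σ : Type} (s : Set σ) (a : σ) :
    (X a : MvPolynomial σ k) ∈ Ideal.span (Set.image (X : σ → MvPolynomial σ k) s) ↔ a ∈ s := by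
  classical
  refine ⟨fun h => ?_, fun h => Ideal.subset_span ⟨a, h, rfl⟩⟩
  rw [span_X_eq_ker, RingHom.mem_ker] at h
  by_contra ha
  simp [killVars, ha] at h

lemma height_span_X_ge (k : Type) [Field k] {σ : Type} (s : Finset σ) :
    (s.card : ℕ∞) ≤ Order.height (⟨_, span_X_prime k (s : Set σ)⟩ :
      PrimeSpectrum (MvPolynomial σ k)) := by
  classical
  induction s using Finset.induction_on with
  | empty => simp
  | insert a s ha ih =>
    rw [Finset.card_insert_of_notMem ha, Nat.cast_add, Nat.cast_one]
    refine le_trans (add_le_add_left ih 1) (Order.height_add_one_le ?_)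
    rw [← PrimeSpectrum.asIdeal_lt_asIdeal]
    apply lt_of_le_of_ne
    · exact Ideal.span_mono (Set.image_mono (by simp))
    · intro h
      have h1 : (X a : MvPolynomial σ k) ∈ Ideal.span (Set.image (X : σ → MvPolynomial σ k) (s : Set σ)) := by
        change _ = Ideal.span _ at h
        change Ideal.span _ = _ at h
        rw [h, X_mem_span_X]
        simp
      rw [X_mem_span_X] at h1
      exact ha (by simpa using h1)

lemma height_span_X_le (k : Type) [Field k] {σ : Type} [Finite σ] (s : Finset σ) :
    Order.height (⟨_, span_X_prime k (s : Set σ)⟩ :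
      PrimeSpectrum (MvPolynomial σ k)) ≤ (s.card : ℕ∞) := by
  classical
  have hP := span_X_prime k (s : Set σ)
  have h1 : Ideal.span (Set.image (X : σ → MvPolynomial σ k) (s : Set σ)) ∈
      (Ideal.span ((s.image (X : σ → MvPolynomial σ k) : Finset _) : Set _)).minimalPrimes := by
    rw [Finset.coe_image, Ideal.minimalPrimes_eq_subsingleton_self]
    rfl
  have h2 := Ideal.height_le_card_of_mem_minimalPrimes_span_finset h1
  have h3 := (PrimeSpectrum.height_eq_orderHeight (⟨_, hP⟩ : PrimeSpectrum (MvPolynomial σ k)))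
  refine le_trans (le_of_eq ?_) (h2.trans (by exact_mod_cast Finset.card_image_le))
  exact h3.symm

lemma cycle_parity (n : ℕ) (g : Sym2 (Fin (n + 3)) → Bool) (e₀ : Sym2 (Fin (n + 3)))
    (h₀ : e₀ ∈ (SimpleGraph.cycleGraph (n + 3)).edgeSet) :
    ∃ A : Finset (Fin (n + 3)), ∀ e ∈ (SimpleGraph.cycleGraph (n + 3)).edgeSet, e ≠ e₀ →
      crossBool A e = g e := by
  have key : ∀ e ∈ (SimpleGraph.cycleGraph (n + 3)).edgeSet,
      ∃ v : Fin (n + 3), e = s(v, v + 1) := by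
    intro e
    induction e using Sym2.ind with
    | _ x y =>
      intro h
      rw [SimpleGraph.mem_edgeSet, SimpleGraph.cycleGraph_adj] at h
      rcases h with h | h
      · refine ⟨y, ?_⟩
        rw [← h, Sym2.eq_swap]; simp
      · refine ⟨x, ?_⟩
        rw [← h]; simp
  obtain ⟨v, rfl⟩ := key e₀ h₀
  obtain ⟨F, hF⟩ : ∃ F : ℕ → Bool, ∀ j, F (j + 1) =
      xor (F j) (g s(v + 1 + Fin.ofNat (n + 3) j, v + 1 + Fin.ofNat (n + 3) j + 1)) :=
    ⟨fun j => Nat.rec (motive := fun _ => Bool) false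
      (fun j b => xor b (g s(v + 1 + Fin.ofNat (n + 3) j, v + 1 + Fin.ofNat (n + 3) j + 1))) j,
      fun j => rfl⟩
  refine ⟨Finset.univ.filter (fun w : Fin (n + 3) => F (w - (v + 1)).val = true), ?_⟩
  intro e he hne
  obtain ⟨w, rfl⟩ := key e he
  have hwv : w ≠ v := by rintro rfl; exact hne rfl
  have hval : (w + 1 - (v + 1)).val = (w - (v + 1)).val + 1 := by
    have e1 : w + 1 - (v + 1) = (w - (v + 1)) + 1 := by abel
    rw [e1, Fin.val_add_one_of_lt]
    rw [Fin.lt_last_iff_ne_last]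
    intro h
    apply hwv
    have e2 : w - (v + 1) + 1 = 0 := by rw [h, Fin.last_add_one]
    have e3 : w - (v + 1) + 1 = w - v := by abel
    rw [e3] at e2
    exact sub_eq_zero.1 e2
  have hw : v + 1 + Fin.ofNat (n + 3) (w - (v + 1)).val = w := by
    rw [Fin.ofNat_val_eq_self]; abel
  simp only [crossBool, Sym2.lift_mk, Finset.mem_filter, Finset.mem_univ, true_and, hval, hF, hw]
  cases F (w - (v + 1)).val <;> cases g s(w, w + 1) <;> rfl

lemma cycle_card (n : ℕ) [Fintype (SimpleGraph.cycleGraph (n + 3)).edgeSet] :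
    Fintype.card (SimpleGraph.cycleGraph (n + 3)).edgeSet = n + 3 := by
  classical
  have h := (SimpleGraph.cycleGraph (n + 3)).sum_degrees_eq_twice_card_edges
  have hd : ∀ v, (SimpleGraph.cycleGraph (n + 3)).degree v = 2 := fun v => by
    convert SimpleGraph.cycleGraph_degree_three_le (v := v)
  simp only [hd] at h
  rw [← SimpleGraph.edgeFinset_card]
  simp only [Finset.sum_const, Finset.card_univ, Fintype.card_fin, smul_eq_mul] at h
  have h2 : (n + 3) * 2 = 2 * (SimpleGraph.cycleGraph (n + 3)).edgeFinset.card := by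
    convert h
  omega

lemma cutGen_mem_iff {k : Type} [Field k] {V : Type} [DecidableEq V]
    {G : SimpleGraph V} [Fintype G.edgeSet] {p : Ideal (MvPolynomial (↥G.edgeSet × Bool) k)}
    (hp : p.IsPrime) (h : ↑G.edgeSet.toFinset ⊆ G.edgeSet) (A : Finset V) :
    cutGen k G G.edgeSet.toFinset h A ∈ p ↔
      ∃ e : G.edgeSet, X (e, crossBool A e.1) ∈ p := by
  rw [cutGen, hp.prod_mem_iff]
  constructor
  · rintro ⟨e, -, he⟩
    exact ⟨_, he⟩
  · rintro ⟨e, he⟩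
    exact ⟨⟨e.1, by simp⟩, by simp, he⟩

lemma cutIdeal_le_iff {k : Type} [Field k] {V : Type} [DecidableEq V]
    {G : SimpleGraph V} [Fintype G.edgeSet] {p : Ideal (MvPolynomial (↥G.edgeSet × Bool) k)}
    (hp : p.IsPrime) :
    cutIdeal k G ≤ p ↔ ∀ A : Finset V, ∃ e : G.edgeSet, X (e, crossBool A e.1) ∈ p := by
  rw [cutIdeal, cutIdealOn, Ideal.span_le, Set.range_subset_iff]
  exact forall_congr' fun A => cutGen_mem_iff hp _ A

end helpers

/-- For the cycle `C_r` (`r ≥ 3`), every minimal prime of `S/I(C_r)` of height at least 3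
has height exactly `|E(C_r)| = r`. -/
theorem monomial_cut_ideal_cycle_minimal_primes_big_height
    (k : Type) [Field k] (r : ℕ) (hr : 3 ≤ r)
    [DecidableRel (SimpleGraph.cycleGraph r).Adj]
    [Fintype (SimpleGraph.cycleGraph r).edgeSet]
    (p : Ideal (MvPolynomial (↥(SimpleGraph.cycleGraph r).edgeSet × Bool) k))
    (hp : p ∈ (cutIdeal k (SimpleGraph.cycleGraph r)).minimalPrimes)
    (hprime : p.IsPrime)
    (hht : 3 ≤ Order.height
      (⟨p, hprime⟩ : PrimeSpectrum (MvPolynomial (↥(SimpleGraph.cycleGraph r).edgeSet × Bool) k))) :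
    Order.height
        (⟨p, hprime⟩ : PrimeSpectrum (MvPolynomial (↥(SimpleGraph.cycleGraph r).edgeSet × Bool) k))
      = (r : ℕ∞) ∧ Fintype.card ↥(SimpleGraph.cycleGraph r).edgeSet = r := by
  classical
  obtain ⟨n, rfl⟩ : ∃ n, r = n + 3 := ⟨r - 3, by omega⟩
  have hcard := cycle_card n
  refine ⟨?_, hcard⟩
  have hI := (cutIdeal_le_iff hprime).1 hp.1.2
  -- a finite set of variables contained in `p` that is a cover spans `p`
  have key : ∀ s : Finset ((SimpleGraph.cycleGraph (n + 3)).edgeSet × Bool),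
      (∀ x ∈ s, X x ∈ p) →
      (∀ A : Finset (Fin (n + 3)), ∃ e : (SimpleGraph.cycleGraph (n + 3)).edgeSet,
        (e, crossBool A e.1) ∈ s) →
      Order.height (⟨p, hprime⟩ : PrimeSpectrum
        (MvPolynomial (↥(SimpleGraph.cycleGraph (n + 3)).edgeSet × Bool) k)) = (s.card : ℕ∞) := by
    intro s hs hcov
    have hQ := span_X_prime k (s : Set ((SimpleGraph.cycleGraph (n + 3)).edgeSet × Bool))
    have hQp : Ideal.span (Set.image (X : _ → MvPolynomial _ k)
        (s : Set ((SimpleGraph.cycleGraph (n + 3)).edgeSet × Bool))) ≤ p := by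
      rw [Ideal.span_le]
      rintro _ ⟨x, hx, rfl⟩
      exact hs x hx
    have hIQ := (cutIdeal_le_iff (G := SimpleGraph.cycleGraph (n + 3)) hQ).2 (by
      intro A
      obtain ⟨e, he⟩ := hcov A
      exact ⟨e, (X_mem_span_X k _ _).2 he⟩)
    have hpQ := hp.2 ⟨hQ, hIQ⟩ hQp
    have heq := le_antisymm hpQ hQp
    subst heq
    exact le_antisymm (height_span_X_le k s) (height_span_X_ge k s)
  have hnot : ∀ e : (SimpleGraph.cycleGraph (n + 3)).edgeSet,
      ¬ (X (e, true) ∈ p ∧ X (e, false) ∈ p) := by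
    rintro e ⟨h1, h2⟩
    have h := key {(e, true), (e, false)} (by
      intro x hx
      simp only [Finset.mem_insert, Finset.mem_singleton] at hx
      rcases hx with rfl | rfl
      · exact h1
      · exact h2) (by
      intro A
      refine ⟨e, ?_⟩
      cases crossBool A e.1 <;> simp)
    rw [h, Finset.card_pair (by simp)] at hht
    exact absurd hht (by decide)
  -- a choice of labels avoiding `p` whenever possible
  have hex : ∀ e : (SimpleGraph.cycleGraph (n + 3)).edgeSet, ∃ b : Bool, X (e, b) ∈ p := by
    intro e₀
    by_contra! hno
    obtain ⟨A, hA⟩ := cycle_parity n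
      (fun e => if h : e ∈ (SimpleGraph.cycleGraph (n + 3)).edgeSet then
        decide (¬ X ((⟨e, h⟩ : (SimpleGraph.cycleGraph (n + 3)).edgeSet), true) ∈ p) else true)
      e₀.1 e₀.2
    obtain ⟨e, he⟩ := hI A
    by_cases hee : e = e₀
    · subst hee
      exact hno _ he
    · rw [hA e.1 e.2 (fun h => hee (Subtype.ext h)), dif_pos e.2] at he
      by_cases ht : X (e, true) ∈ p
      · simp only [Subtype.coe_eta, ht, not_true_eq_false, decide_false] at he
        exact hnot e ⟨ht, he⟩
      · simp only [Subtype.coe_eta, ht, not_false_eq_true, decide_true] at he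
  choose f hf using hex
  have hfu : ∀ e b, X (e, b) ∈ p → b = f e := by
    intro e b hb
    have h1 := hnot e
    have h2 := hf e
    revert hb h2
    cases b <;> cases f e
    · exact fun _ _ => rfl
    · exact fun hb h2 => absurd ⟨h2, hb⟩ h1
    · exact fun hb h2 => absurd ⟨hb, h2⟩ h1
    · exact fun _ _ => rfl
  have h := key (Finset.univ.image fun e => (e, f e)) (by
    intro x hx
    simp only [Finset.mem_image, Finset.mem_univ, true_and] at hx
    obtain ⟨e, rfl⟩ := hx
    exact hf e) (by
    intro A
    obtain ⟨e, he⟩ := hI A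
    refine ⟨e, ?_⟩
    simp [hfu _ _ he])
  rw [h, Finset.card_image_of_injective _ (fun a b hab => (Prod.ext_iff.1 hab).1),
    Finset.card_univ, hcard]
end

section
/- Let r ≥ 4 be an even integer and C_r the cycle on vertices {1,…,r} with edges {i,i+1} (indices modulo r). Then I(C_r) = ⋂_{m ∈ M_o(C_r)} (supp(m)) ∩ ⋂_{{i,i+1} ∈ E(C_r)} (s_{i,i+1}, t_{i,i+1}), where (supp(m)) denotes the prime ideal generated by the variables dividing m, and this is the minimal primary decomposition of I(C_r). -/
open MvPolynomial

/-- The exponent vectors of the monomials in `M_o(C_r)`: squarefree, of total degree `r`,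
with odd `s`-degree, and divisible by no product `s_e * t_e`. -/
def MoExp (r : ℕ) [Fintype (SimpleGraph.cycleGraph r).edgeSet] :
    Set ((↥(SimpleGraph.cycleGraph r).edgeSet × Bool) →₀ ℕ) :=
  {d | (∀ v, d v ≤ 1) ∧ (d.sum fun _ n => n) = r ∧
    Odd (∑ e : ↥(SimpleGraph.cycleGraph r).edgeSet, d (e, true)) ∧
    ∀ e : ↥(SimpleGraph.cycleGraph r).edgeSet, ¬ (d (e, true) ≠ 0 ∧ d (e, false) ≠ 0)}

theorem aux_span_X_isPrime (k : Type) [Field k] {σ : Type} (s : Set σ) :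
    (Ideal.span ((fun v => (X v : MvPolynomial σ k)) '' s)).IsPrime := by
  classical
  let φ : MvPolynomial σ k →ₐ[k] MvPolynomial σ k := aeval (fun v => if v ∈ s then 0 else X v)
  have h : Ideal.span ((fun v => (X v : MvPolynomial σ k)) '' s) = RingHom.ker φ.toRingHom := by
    apply le_antisymm
    · rw [Ideal.span_le]
      rintro _ ⟨v, hv, rfl⟩
      simp [RingHom.mem_ker, φ, hv]
    · intro p hp
      have key : ∀ q : MvPolynomial σ k,
          q - φ q ∈ Ideal.span ((fun v => (X v : MvPolynomial σ k)) '' s) := by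
        intro q
        induction q using MvPolynomial.induction_on with
        | C a => simp [φ]
        | add p q hp hq =>
          have := Ideal.add_mem _ hp hq
          rw [map_add]
          convert this using 1
          ring
        | mul_X p v hp =>
          rw [map_mul]
          by_cases hv : v ∈ s
          · have : φ (X v) = 0 := by simp [φ, hv]
            rw [this, mul_zero, sub_zero]
            exact Ideal.mul_mem_left _ _ (Ideal.subset_span ⟨v, hv, rfl⟩)
          · have : φ (X v) = X v := by simp [φ, hv]
            rw [this, ← sub_mul]
            exact Ideal.mul_mem_right _ _ hp
      have h0 : φ p = 0 := hp
      have := key p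
      rwa [h0, sub_zero] at this
  rw [h]
  exact RingHom.ker_isPrime _

theorem aux_X_mem (k : Type) [Field k] {σ : Type} (s : Set σ) (v : σ) :
    (X v : MvPolynomial σ k) ∈ Ideal.span ((fun v => (X v : MvPolynomial σ k)) '' s) ↔ v ∈ s := by
  classical
  rw [mem_ideal_span_X_image]
  simp [support_X, Finsupp.single_apply]

/-- parity of a Boolean assignment -/
def auxPar {E : Type} [Fintype E] (b : E → Bool) : ℕ := ∑ e, (b e).toNat

theorem auxPar_not {E : Type} [Fintype E] (hE : Even (Fintype.card E)) (b : E → Bool) :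
    Even (auxPar (fun e => !b e)) ↔ Even (auxPar b) := by
  have : auxPar (fun e => !b e) + auxPar b = Fintype.card E := by
    unfold auxPar
    rw [← Finset.sum_add_distrib, Fintype.card_eq_sum_ones]
    apply Finset.sum_congr rfl
    intro e _
    cases h : b e <;> simp [h]
  rw [← this, Nat.even_add] at hE
  exact hE

theorem auxPar_update {E : Type} [Fintype E] [DecidableEq E] (b : E → Bool) (e : E) :
    Even (auxPar (Function.update b e (!b e))) ↔ ¬ Even (auxPar b) := by
  unfold auxPar
  rw [← Finset.add_sum_erase _ _ (Finset.mem_univ e), ← Finset.add_sum_erase (a := e) Finset.univ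
    (fun e => (b e).toNat) (Finset.mem_univ e)]
  have : ∑ x ∈ Finset.univ.erase e, (Function.update b e (!b e) x).toNat
      = ∑ x ∈ Finset.univ.erase e, (b x).toNat := by
    apply Finset.sum_congr rfl
    intro x hx
    rw [Function.update_of_ne (Finset.ne_of_mem_erase hx)]
  rw [this, Function.update_self, Nat.even_add, Nat.even_add]
  cases b e <;> simp

theorem aux_comb {E : Type} [Fintype E] (hE : Even (Fintype.card E)) (T : Set (E × Bool)) :
    (∃ b : E → Bool, Even (auxPar b) ∧ ∀ e, (e, b e) ∈ T) ∨
    (∃ e, (e, true) ∉ T ∧ (e, false) ∉ T) ∨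
    (∃ c : E → Bool, ¬ Even (auxPar c) ∧ ∀ e, (e, c e) ∉ T) := by
  classical
  by_cases h2 : ∃ e, (e, true) ∉ T ∧ (e, false) ∉ T
  · exact Or.inr (Or.inl h2)
  have h : ∀ e, ∃ x, (e, x) ∈ T := by
    intro e
    by_contra hcon
    push Not at hcon
    exact h2 ⟨e, hcon _, hcon _⟩
  choose b hb using h
  by_cases hev : Even (auxPar b)
  · exact Or.inl ⟨b, hev, hb⟩
  by_cases hx : ∃ e, (e, !b e) ∈ T
  · obtain ⟨e, he⟩ := hx
    refine Or.inl ⟨Function.update b e (!b e), (auxPar_update b e).2 hev, fun x => ?_⟩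
    by_cases hxe : x = e
    · subst hxe; simpa using he
    · simpa [Function.update_of_ne hxe] using hb x
  · push Not at hx
    exact Or.inr (Or.inr ⟨fun e => !b e, by rwa [auxPar_not hE], hx⟩)

theorem aux_even_sum {n : ℕ} (p : Fin (n + 1) → Bool) :
    Even (∑ i, (xor (p i) (p (i + 1))).toNat) := by
  have h : ∀ x y : Bool, (((xor x y).toNat : ℕ) : ZMod 2) = (x.toNat : ZMod 2) + (y.toNat : ZMod 2) := by
    decide
  rw [← ZMod.natCast_eq_zero_iff_even]
  push_cast
  simp_rw [h]
  rw [Finset.sum_add_distrib]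
  have := Equiv.sum_comp (Equiv.addRight (1 : Fin (n + 1))) (fun i => ((p i).toNat : ZMod 2))
  simp only [Equiv.coe_addRight] at this
  rw [this]
  exact CharTwo.add_self_eq_zero _

/-- partial parity -/
def auxPre (g : ℕ → Bool) : ℕ → Bool
  | 0 => false
  | n + 1 => xor (auxPre g n) (g n)

theorem auxPre_sum (g : ℕ → Bool) (n : ℕ) :
    auxPre g n = false ↔ Even (∑ i ∈ Finset.range n, (g i).toNat) := by
  induction n with
  | zero => simp [auxPre]
  | succ n ih =>
    rw [Finset.sum_range_succ, Nat.even_add, ← ih, auxPre]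
    cases auxPre g n <;> cases g n <;> simp

theorem aux_exists_pot {n : ℕ} (b : Fin (n + 1) → Bool) (hb : Even (∑ i, (b i).toNat)) :
    ∃ p : Fin (n + 1) → Bool, ∀ i, xor (p i) (p (i + 1)) = b i := by
  let g : ℕ → Bool := fun i => if h : i < n + 1 then b ⟨i, h⟩ else false
  have hg : ∀ i : Fin (n + 1), g i = b i := fun i => by
    simp only [g]
    rw [dif_pos i.isLt]
  have hlast : auxPre g (n + 1) = false := by
    rw [auxPre_sum, ← Fin.sum_univ_eq_sum_range (fun i => (g i).toNat)]
    simpa [hg] using hb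
  refine ⟨fun i => auxPre g i, fun i => ?_⟩
  by_cases hi : i = Fin.last n
  · subst hi
    have h1 : auxPre g (n + 1) = xor (auxPre g n) (g n) := rfl
    rw [hlast] at h1
    have h2 := hg (Fin.last n)
    simp only [Fin.val_last] at h2
    rw [h2] at h1
    simp only [Fin.last_add_one, Fin.val_last, Fin.val_zero, auxPre]
    revert h1
    cases auxPre g n <;> cases b (Fin.last n) <;> decide
  · have : ((i + 1 : Fin (n + 1)) : ℕ) = i + 1 := Fin.val_add_one_of_lt (Fin.lt_last_iff_ne_last.2 hi)
    simp only [this, auxPre, hg]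
    cases auxPre g i <;> cases b i <;> rfl

theorem aux_edge_equiv (n : ℕ) :
    ∃ f : Fin (n + 4) ≃ (SimpleGraph.cycleGraph (n + 4)).edgeSet,
      ∀ i, (f i).1 = s(i, i + 1) := by
  have hmem : ∀ i : Fin (n + 4), s(i, i + 1) ∈ (SimpleGraph.cycleGraph (n + 4)).edgeSet := by
    intro i
    rw [SimpleGraph.mem_edgeSet, SimpleGraph.cycleGraph_adj]
    right; simp
  let f : Fin (n + 4) → (SimpleGraph.cycleGraph (n + 4)).edgeSet := fun i => ⟨s(i, i + 1), hmem i⟩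
  have hf : Function.Bijective f := by
    constructor
    · intro i j hij
      have h := congrArg Subtype.val hij
      simp only [f, Sym2.eq_iff] at h
      rcases h with ⟨h, -⟩ | ⟨h1, h2⟩
      · exact h
      · exfalso
        rw [h1, add_assoc] at h2
        have h3 : (1 : Fin (n + 4)) + 1 = 0 := by simpa using h2
        have := congrArg Fin.val h3
        simp only [Fin.val_add, Fin.val_one, Fin.val_zero] at this
        rw [Nat.mod_eq_of_lt (by omega)] at this
        omega
    · rintro ⟨e, he⟩
      induction e with | _ u v =>
      rw [SimpleGraph.mem_edgeSet, SimpleGraph.cycleGraph_adj] at he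
      rcases he with h | h
      · refine ⟨v, Subtype.ext ?_⟩
        have : u = v + 1 := by rw [← h]; abel
        simp [f, this, Sym2.eq_swap]
      · refine ⟨u, Subtype.ext ?_⟩
        have : v = u + 1 := by rw [← h]; abel
        simp [f, this]
  exact ⟨Equiv.ofBijective f hf, fun i => rfl⟩

theorem aux_cross_iff (r : ℕ) (hr : 4 ≤ r) [Fintype (SimpleGraph.cycleGraph r).edgeSet]
    (b : (SimpleGraph.cycleGraph r).edgeSet → Bool) :
    (∃ A : Finset (Fin r), ∀ e, crossBool A e.1 = b e) ↔ Even (auxPar b) := by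
  obtain ⟨n, rfl⟩ : ∃ n, r = n + 4 := ⟨r - 4, by omega⟩
  obtain ⟨f, hf⟩ := aux_edge_equiv n
  have hs : auxPar b = ∑ i, (b (f i)).toNat := (Equiv.sum_comp f (fun e => (b e).toNat)).symm
  rw [hs]
  constructor
  · rintro ⟨A, hA⟩
    convert aux_even_sum (fun i => decide (i ∈ A)) with i
    rw [← hA, hf]
    rfl
  · intro h
    obtain ⟨p, hp⟩ := aux_exists_pot (fun i => b (f i)) h
    refine ⟨Finset.univ.filter (fun i => p i = true), fun e => ?_⟩
    obtain ⟨i, rfl⟩ := f.surjective e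
    rw [hf, ← hp]
    simp [crossBool]

theorem aux_card (r : ℕ) (hr : 4 ≤ r) [Fintype (SimpleGraph.cycleGraph r).edgeSet] :
    Fintype.card (SimpleGraph.cycleGraph r).edgeSet = r := by
  obtain ⟨n, rfl⟩ : ∃ n, r = n + 4 := ⟨r - 4, by omega⟩
  obtain ⟨f, hf⟩ := aux_edge_equiv n
  rw [← Fintype.card_congr f, Fintype.card_fin]

/-- exponent vector of an assignment -/
noncomputable def auxExp {E : Type} [Fintype E] (b : E → Bool) : (E × Bool) →₀ ℕ :=
  ∑ e, Finsupp.single (e, b e) 1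

theorem auxExp_apply {E : Type} [Fintype E] (b : E → Bool) (v : E × Bool) :
    auxExp b v = if b v.1 = v.2 then 1 else 0 := by
  classical
  obtain ⟨e, x⟩ := v
  simp only [auxExp, Finsupp.finsetSum_apply, Finsupp.single_apply, Prod.mk.injEq]
  rw [Finset.sum_eq_single e]
  · simp
  · intro a _ ha; simp [ha]
  · simp

theorem aux_cutIdeal (k : Type) [Field k] (r : ℕ) (hr : 4 ≤ r)
    [Fintype (SimpleGraph.cycleGraph r).edgeSet] :
    cutIdeal k (SimpleGraph.cycleGraph r) =
      Ideal.span ((fun s => monomial s (1 : k)) '' {d | ∃ b, Even (auxPar b) ∧ d = auxExp b}) := by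
  have hgen : ∀ A : Finset (Fin r), cutGen k (SimpleGraph.cycleGraph r)
      (SimpleGraph.cycleGraph r).edgeSet.toFinset (by simp) A =
      monomial (auxExp (fun e : (SimpleGraph.cycleGraph r).edgeSet => crossBool A e.1)) (1 : k) := by
    intro A
    rw [auxExp, monomial_sum_one]
    unfold cutGen
    refine Finset.prod_bij' (fun e _ => ⟨e.1, Set.mem_toFinset.1 e.2⟩)
      (fun e _ => ⟨e.1, by simp⟩) ?_ ?_ ?_ ?_ ?_ <;> simp [X]
  unfold cutIdeal cutIdealOn
  congr 1
  ext p
  constructor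
  · rintro ⟨A, rfl⟩
    exact ⟨_, ⟨_, (aux_cross_iff r hr _).1 ⟨A, fun e => rfl⟩, rfl⟩, (hgen A).symm⟩
  · rintro ⟨_, ⟨b, hb, rfl⟩, rfl⟩
    obtain ⟨A, hA⟩ := (aux_cross_iff r hr b).2 hb
    refine ⟨A, ?_⟩
    rw [hgen]
    have : (fun e : (SimpleGraph.cycleGraph r).edgeSet => crossBool A e.1) = b := funext hA
    rw [this]

theorem aux_Mo (r : ℕ) (hr : 4 ≤ r) [Fintype (SimpleGraph.cycleGraph r).edgeSet]
    (d : (↥(SimpleGraph.cycleGraph r).edgeSet × Bool) →₀ ℕ) :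
    d ∈ MoExp r ↔ ∃ c, ¬ Even (auxPar c) ∧ d = auxExp c := by
  have hsum : ∀ d : (↥(SimpleGraph.cycleGraph r).edgeSet × Bool) →₀ ℕ,
      (d.sum fun _ n => n) = ∑ e, (d (e, true) + d (e, false)) := by
    intro d
    rw [Finsupp.sum_fintype _ _ (by simp), Fintype.sum_prod_type]
    simp
  have hcard := aux_card r hr
  constructor
  · rintro ⟨h1, h2, h3, h4⟩
    rw [hsum] at h2
    have hle : ∀ e ∈ Finset.univ, d (e, true) + d (e, false) ≤ 1 := by
      intro e _
      have := h1 (e, true); have := h1 (e, false); have := h4 e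
      omega
    have heq : ∀ e ∈ Finset.univ, d (e, true) + d (e, false) = 1 := by
      apply (Finset.sum_eq_sum_iff_of_le hle).1
      rw [h2, ← Fintype.card_eq_sum_ones, hcard]
    have hd : d = auxExp (fun e => decide (d (e, true) = 1)) := by
      ext ⟨e, x⟩
      rw [auxExp_apply]
      have := heq e (Finset.mem_univ _)
      cases x <;> simp <;> split_ifs <;> omega
    refine ⟨_, ?_, hd⟩
    rw [Nat.not_even_iff_odd]
    convert h3 using 1
    unfold auxPar
    apply Finset.sum_congr rfl
    intro e _
    have := heq e (Finset.mem_univ _)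
    have h : d (e, true) = 0 ∨ d (e, true) = 1 := by omega
    rcases h with h | h <;> simp [h]
  · rintro ⟨c, hc, rfl⟩
    refine ⟨?_, ?_, ?_, ?_⟩
    · intro v; rw [auxExp_apply]; split_ifs <;> simp
    · rw [hsum]
      refine Eq.trans ?_ hcard
      rw [Fintype.card_eq_sum_ones]
      apply Finset.sum_congr rfl
      intro e _
      simp only [auxExp_apply]
      cases c e <;> simp
    · rw [Nat.not_even_iff_odd] at hc
      convert hc using 1
      unfold auxPar
      apply Finset.sum_congr rfl
      intro e _
      simp only [auxExp_apply]
      cases c e <;> simp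
    · intro e
      simp only [auxExp_apply]
      cases c e <;> simp

theorem aux_monomial_mem_prime {k : Type} [Field k] {E : Type} [Fintype E] (b : E → Bool)
    (P : Ideal (MvPolynomial (E × Bool) k)) (hP : P.IsPrime)
    (h : monomial (auxExp b) (1 : k) ∈ P) : ∃ e, X (e, b e) ∈ P := by
  rw [auxExp, monomial_sum_one] at h
  obtain ⟨e, -, he⟩ := (Ideal.IsPrime.prod_mem_iff (hp := hP)).1 h
  exact ⟨e, he⟩

/-- the prime attached to an assignment -/
theorem aux_supp {E : Type} [Fintype E] (c : E → Bool) :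
    {v | auxExp c v ≠ 0} = {v : E × Bool | c v.1 = v.2} := by
  ext v
  simp [auxExp_apply]

theorem aux_pair (k : Type) [Field k] {E : Type} (e : E) :
    (Ideal.span {X ((e, true) : E × Bool), X ((e, false) : E × Bool)} :
      Ideal (MvPolynomial (E × Bool) k)) =
    Ideal.span ((fun v => (X v : MvPolynomial (E × Bool) k)) '' {v | v.1 = e}) := by
  congr 1
  ext p
  constructor
  · rintro (rfl | rfl)
    · exact ⟨_, rfl, rfl⟩
    · exact ⟨_, rfl, rfl⟩
  · rintro ⟨⟨e', x⟩, rfl, rfl⟩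
    cases x <;> simp

theorem aux_span_mono (k : Type) [Field k] {σ : Type} (s t : Set σ) :
    Ideal.span ((fun v => (X v : MvPolynomial σ k)) '' s) ≤
      Ideal.span ((fun v => (X v : MvPolynomial σ k)) '' t) ↔ s ⊆ t := by
  constructor
  · intro h v hv
    rw [← aux_X_mem k]
    exact h ((aux_X_mem k s v).2 hv)
  · intro h
    exact Ideal.span_mono (Set.image_mono h)

set_option maxHeartbeats 1000000 in
theorem aux_main (k : Type) [Field k] {E : Type} [Fintype E] (hE : Even (Fintype.card E))
    (h3 : 3 ≤ Fintype.card E) (I : Ideal (MvPolynomial (E × Bool) k))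
    (hI : I = Ideal.span ((fun s => monomial s (1 : k)) ''
      {d | ∃ b : E → Bool, Even (auxPar b) ∧ d = auxExp b})) (M : Set ((E × Bool) →₀ ℕ))
    (hM : ∀ d, d ∈ M ↔ ∃ c : E → Bool, ¬ Even (auxPar c) ∧ d = auxExp c) :
    I = (⨅ d ∈ M, Ideal.span ((fun v => (X v : MvPolynomial (E × Bool) k)) '' {v | d v ≠ 0})) ⊓
      (⨅ e : E, Ideal.span {X ((e, true) : E × Bool), X ((e, false) : E × Bool)}) ∧
    I.minimalPrimes =
      {p | ∃ d ∈ M,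
        p = Ideal.span ((fun v => (X v : MvPolynomial (E × Bool) k)) '' {v | d v ≠ 0})} ∪
      Set.range (fun e : E => Ideal.span {X ((e, true) : E × Bool), X ((e, false) : E × Bool)}) := by
  classical
  simp_rw [aux_pair]
  have hle1 : ∀ d ∈ M, I ≤
      Ideal.span ((fun v => (X v : MvPolynomial (E × Bool) k)) '' {v | d v ≠ 0}) := by
    intro d hd
    obtain ⟨c, hc, rfl⟩ := (hM d).1 hd
    rw [aux_supp, hI, Ideal.span_le]
    rintro _ ⟨_, ⟨b, hb, rfl⟩, rfl⟩
    simp only [SetLike.mem_coe]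
    rw [mem_ideal_span_X_image]
    intro m hm
    have hm : m = auxExp b := by simpa [support_monomial] using hm
    subst hm
    have : ∃ e, b e = c e := by
      by_contra hcon
      push Not at hcon
      apply hc
      have : c = fun e => !b e := by
        funext e
        have := hcon e
        cases h1 : b e <;> cases h2 : c e <;> simp_all
      rw [this, auxPar_not hE]
      exact hb
    obtain ⟨e, he⟩ := this
    exact ⟨(e, c e), rfl, by simp [auxExp_apply, he]⟩
  have hle2 : ∀ e : E, I ≤
      Ideal.span ((fun v => (X v : MvPolynomial (E × Bool) k)) '' {v | v.1 = e}) := by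
    intro e
    rw [hI, Ideal.span_le]
    rintro _ ⟨_, ⟨b, hb, rfl⟩, rfl⟩
    simp only [SetLike.mem_coe]
    rw [mem_ideal_span_X_image]
    intro m hm
    have hm : m = auxExp b := by simpa [support_monomial] using hm
    subst hm
    exact ⟨(e, b e), rfl, by simp [auxExp_apply]⟩
  have hcov : ∀ P : Ideal (MvPolynomial (E × Bool) k), P.IsPrime → I ≤ P →
      (∃ d ∈ M, Ideal.span ((fun v => (X v : MvPolynomial (E × Bool) k)) '' {v | d v ≠ 0}) ≤ P) ∨
      (∃ e : E, Ideal.span ((fun v => (X v : MvPolynomial (E × Bool) k)) '' {v | v.1 = e}) ≤ P) := by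
    intro P hP hIP
    rcases aux_comb hE {v | X v ∉ P} with ⟨b, hb, h⟩ | ⟨e, h, h'⟩ | ⟨c, hc, h⟩
    · exfalso
      have hmem : monomial (auxExp b) (1 : k) ∈ P := by
        apply hIP
        rw [hI]
        exact Ideal.subset_span ⟨_, ⟨b, hb, rfl⟩, rfl⟩
      obtain ⟨e, he⟩ := aux_monomial_mem_prime b P hP hmem
      exact h e he
    · right
      refine ⟨e, ?_⟩
      rw [Ideal.span_le]
      rintro _ ⟨⟨e', x⟩, rfl, rfl⟩
      simp only [Set.mem_ofPred_eq, not_not] at h h'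
      cases x <;> assumption
    · left
      refine ⟨_, (hM _).2 ⟨c, hc, rfl⟩, ?_⟩
      rw [aux_supp, Ideal.span_le]
      rintro _ ⟨⟨e, x⟩, hx, rfl⟩
      have := h e
      simp only [Set.mem_ofPred_eq, not_not] at this hx
      subst hx
      exact this
  constructor
  · apply le_antisymm
    · exact le_inf (le_iInf₂ hle1) (le_iInf hle2)
    · intro p hp
      simp only [Submodule.mem_inf, Submodule.mem_iInf] at hp
      obtain ⟨hp1, hp2⟩ := hp
      rw [hI, mem_ideal_span_monomial_image]
      intro m hm
      rcases aux_comb hE {v | m v ≠ 0} with ⟨b, hb, h⟩ | ⟨e, h, h'⟩ | ⟨c, hc, h⟩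
      · refine ⟨_, ⟨b, hb, rfl⟩, ?_⟩
        rintro ⟨e, x⟩
        rw [auxExp_apply]
        split_ifs with hx
        · simp only at hx
          subst hx
          exact Nat.one_le_iff_ne_zero.2 (h e)
        · simp
      · exfalso
        obtain ⟨⟨e', x⟩, rfl, hx⟩ := mem_ideal_span_X_image.1 (hp2 e) m hm
        cases x
        · exact h' hx
        · exact h hx
      · exfalso
        have := hp1 _ ((hM _).2 ⟨c, hc, rfl⟩)
        rw [aux_supp] at this
        obtain ⟨⟨e', x⟩, h1, hx⟩ := mem_ideal_span_X_image.1 this m hm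
        simp only [Set.mem_ofPred_eq] at h1
        subst h1
        exact h _ hx
  · -- pairwise incomparability
    have hanti1 : ∀ c c' : E → Bool,
        {v : E × Bool | c v.1 = v.2} ⊆ {v : E × Bool | c' v.1 = v.2} → c = c' := by
      intro c c' h
      funext e
      exact (@h (e, c e) rfl).symm
    have hanti2 : ∀ (c : E → Bool) (e : E),
        ¬ {v : E × Bool | v.1 = e} ⊆ {v : E × Bool | c v.1 = v.2} := by
      intro c e h
      have h1 : c e = true := @h (e, true) rfl
      have h2 : c e = false := @h (e, false) rfl
      rw [h1] at h2
      exact Bool.noConfusion h2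
    have hanti3 : ∀ (c : E → Bool) (e : E),
        ¬ {v : E × Bool | c v.1 = v.2} ⊆ {v : E × Bool | v.1 = e} := by
      intro c e h
      obtain ⟨e', he'⟩ : ∃ e', e' ≠ e := by
        have : Nontrivial E := Fintype.one_lt_card_iff_nontrivial.1 (by omega)
        exact exists_ne e
      exact he' (@h (e', c e') rfl)
    have hanti4 : ∀ (e e' : E),
        {v : E × Bool | v.1 = e} ⊆ {v : E × Bool | v.1 = e'} → e = e' :=
      fun e e' h => @h (e, true) rfl
    ext P
    constructor
    · rintro ⟨⟨hP, hIP⟩, hmin⟩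
      rcases hcov P hP hIP with ⟨d, hd, h⟩ | ⟨e, h⟩
      · left
        exact ⟨d, hd, le_antisymm (hmin ⟨aux_span_X_isPrime k _, hle1 d hd⟩ h) h⟩
      · right
        exact ⟨e, le_antisymm h (hmin ⟨aux_span_X_isPrime k _, hle2 e⟩ h)⟩
    · rintro (⟨d, hd, rfl⟩ | ⟨e, rfl⟩)
      · refine ⟨⟨aux_span_X_isPrime k _, hle1 d hd⟩, ?_⟩
        rintro Q ⟨hQ, hIQ⟩ hQle
        obtain ⟨c, hc, rfl⟩ := (hM d).1 hd
        rw [aux_supp] at hQle ⊢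
        rcases hcov Q hQ hIQ with ⟨d', hd', h⟩ | ⟨e, h⟩
        · obtain ⟨c', hc', rfl⟩ := (hM d').1 hd'
          rw [aux_supp] at h
          have := hanti1 _ _ ((aux_span_mono k _ _).1 (h.trans hQle))
          rwa [this] at h
        · exact absurd ((aux_span_mono k _ _).1 (h.trans hQle)) (hanti2 _ _)
      · refine ⟨⟨aux_span_X_isPrime k _, hle2 e⟩, ?_⟩
        rintro Q ⟨hQ, hIQ⟩ hQle
        rcases hcov Q hQ hIQ with ⟨d', hd', h⟩ | ⟨e', h⟩
        · obtain ⟨c', hc', rfl⟩ := (hM d').1 hd'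
          rw [aux_supp] at h
          exact absurd ((aux_span_mono k _ _).1 (h.trans hQle)) (hanti3 _ _)
        · have := hanti4 _ _ ((aux_span_mono k _ _).1 (h.trans hQle))
          rwa [this] at h

/-- For an even cycle `C_r` (`r ≥ 4` even), the minimal primary decomposition of `I(C_r)` is
`I(C_r) = ⋂_{m ∈ M_o(C_r)} (supp m) ∩ ⋂_{e ∈ E(C_r)} (s_e, t_e)`; minimality is expressed
by the fact that the minimal primes of `I(C_r)` are exactly the primes occurring. -/
theorem monomial_cut_ideal_even_cycle_primary_decomposition
    (k : Type) [Field k] (r : ℕ) (hr : 4 ≤ r) (heven : Even r)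
    [DecidableRel (SimpleGraph.cycleGraph r).Adj]
    [Fintype (SimpleGraph.cycleGraph r).edgeSet] :
    cutIdeal k (SimpleGraph.cycleGraph r) =
      (⨅ d ∈ MoExp r,
        Ideal.span ((fun v => (X v : MvPolynomial (↥(SimpleGraph.cycleGraph r).edgeSet × Bool) k))
          '' {v | d v ≠ 0})) ⊓
      (⨅ e : ↥(SimpleGraph.cycleGraph r).edgeSet,
        Ideal.span {X ((e, true) : ↥(SimpleGraph.cycleGraph r).edgeSet × Bool),
                    X ((e, false) : ↥(SimpleGraph.cycleGraph r).edgeSet × Bool)}) ∧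
    (cutIdeal k (SimpleGraph.cycleGraph r)).minimalPrimes =
      {p | ∃ d ∈ MoExp r,
        p = Ideal.span ((fun v => (X v : MvPolynomial (↥(SimpleGraph.cycleGraph r).edgeSet × Bool) k))
          '' {v | d v ≠ 0})} ∪
      Set.range (fun e : ↥(SimpleGraph.cycleGraph r).edgeSet =>
        Ideal.span {X ((e, true) : ↥(SimpleGraph.cycleGraph r).edgeSet × Bool),
                    X ((e, false) : ↥(SimpleGraph.cycleGraph r).edgeSet × Bool)}) := by
  exact aux_main k (by rw [aux_card r hr]; exact heven) (by rw [aux_card r hr]; omega) _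
    (aux_cutIdeal k r hr) (MoExp r) (aux_Mo r hr)
end

section
/- Let C_r be the cycle on vertices {1,…,r} with edges {i,i+1} for 1 ≤ i ≤ r (indices modulo r), where r ≥ 3. Then I(C_r) has no linear relations among its minimal monomial generators: if u_1 and u_2 are minimal monomial generators of I(C_r) and m_1, m_2 are monomials of degree 1 (variables of S) with m_1 u_1 = m_2 u_2, then u_1 = u_2 (and m_1 = m_2). -/
open MvPolynomial

theorem cycle_parity_aux (n : ℕ) (h : Fin (n+3) → ZMod 2) (i0 : Fin (n+3))
    (hh : ∀ i, i ≠ i0 → h i - h (i+1) = 0) : h i0 - h (i0+1) = 0 := by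
  have h1 : ∑ i, (h i - h (i+1)) = 0 := by
    rw [Finset.sum_sub_distrib, sub_eq_zero]
    exact (Equiv.sum_comp (Equiv.addRight (1 : Fin (n+3))) h).symm
  rw [Finset.sum_eq_single i0 (fun i _ hi => hh i hi) (by simp)] at h1
  exact h1

theorem cycle_edge_aux (n : ℕ) (e : Sym2 (Fin (n+3)))
    (he : e ∈ (SimpleGraph.cycleGraph (n+3)).edgeSet) : ∃ i, e = s(i, i+1) := by
  induction e using Sym2.ind with
  | _ a b =>
    rw [SimpleGraph.mem_edgeSet, SimpleGraph.cycleGraph_adj] at he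
    rcases he with he | he
    · exact ⟨b, by rw [← he, Sym2.eq_swap]; simp⟩
    · exact ⟨a, by rw [← he]; simp⟩

theorem cycle_edge_mem_aux (n : ℕ) (i : Fin (n+3)) :
    s(i, i+1) ∈ (SimpleGraph.cycleGraph (n+3)).edgeSet := by
  rw [SimpleGraph.mem_edgeSet, SimpleGraph.cycleGraph_adj]
  simp

theorem cycle_edge_inj_aux (n : ℕ) (i j : Fin (n+3)) (h : s(i, i+1) = s(j, j+1)) : i = j := by
  rw [Sym2.eq_iff] at h
  rcases h with h | ⟨h1, h2⟩
  · exact h.1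
  · exfalso
    rw [h1, add_assoc] at h2
    have h3 : (1 + 1 : Fin (n+3)) = 0 := by simpa using h2
    have h4 := congrArg Fin.val h3
    simp [Fin.val_add] at h4
    rw [Nat.mod_eq_of_lt (by omega)] at h4
    omega

theorem cross_parity_aux (n : ℕ) (A B : Finset (Fin (n+3))) (i0 : Fin (n+3))
    (hh : ∀ i, i ≠ i0 → crossBool A s(i,i+1) = crossBool B s(i,i+1)) :
    crossBool A s(i0,i0+1) = crossBool B s(i0,i0+1) := by
  have key : ∀ i, (crossBool A s(i,i+1) = crossBool B s(i,i+1)) ↔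
      ((if xor (decide (i ∈ A)) (decide (i ∈ B)) then 1 else 0 : ZMod 2)
        - (if xor (decide (i+1 ∈ A)) (decide (i+1 ∈ B)) then 1 else 0) = 0) := by
    intro i
    simp only [crossBool, Sym2.lift_mk]
    generalize decide (i ∈ A) = a
    generalize decide (i ∈ B) = b
    generalize decide (i+1 ∈ A) = c
    generalize decide (i+1 ∈ B) = d
    revert a b c d
    decide
  rw [key]
  exact cycle_parity_aux n
    (fun i => if xor (decide (i ∈ A)) (decide (i ∈ B)) then 1 else 0) i0
    (fun i hi => (key i).1 (hh i hi))

theorem diff_edge_aux (k : Type) [Field k] {V : Type} [DecidableEq V]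
    (G : SimpleGraph V) (E' : Finset (Sym2 V)) (hE' : ↑E' ⊆ G.edgeSet) (A B : Finset V)
    (v w : ↥G.edgeSet × Bool)
    (h : (X v : MvPolynomial (↥G.edgeSet × Bool) k) * cutGen k G E' hE' A
      = X w * cutGen k G E' hE' B)
    (e : Sym2 V) (he : e ∈ E') (hne : crossBool A e ≠ crossBool B e) : (w.1 : Sym2 V) = e := by
  classical
  by_contra hw
  have h2 := congrArg (eval (fun p : ↥G.edgeSet × Bool =>
    if p = (⟨e, hE' he⟩, crossBool A e) then (0 : k) else 1)) h
  simp only [cutGen, map_mul, map_prod, eval_X] at h2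
  rw [Finset.prod_eq_zero (Finset.mem_attach _ ⟨e, he⟩) (by simp), mul_zero, if_neg,
    one_mul, Finset.prod_eq_one] at h2
  · exact zero_ne_one h2
  · rintro ⟨x, hx⟩ -
    rw [if_neg]
    intro hp
    simp only [Prod.mk.injEq, Subtype.mk.injEq] at hp
    obtain ⟨rfl, hp⟩ := hp
    exact hne hp.symm
  · intro hp
    exact hw (by rw [hp])

/-- For the cycle `C_r` (`r ≥ 3`), `I(C_r)` has no linear relations among its minimal
monomial generators: if `u₁, u₂` are minimal monomial generators of `I(C_r)` and
`X v, X w` are variables with `X v * u₁ = X w * u₂`, then `u₁ = u₂` (and `X v = X w`). -/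
theorem monomial_cut_ideal_cycle_no_linear_relations
    (k : Type) [Field k] (r : ℕ) (hr : 3 ≤ r)
    [DecidableRel (SimpleGraph.cycleGraph r).Adj]
    [Fintype (SimpleGraph.cycleGraph r).edgeSet] :
    ∀ u₁ ∈ Set.range (cutGen k (SimpleGraph.cycleGraph r)
        (SimpleGraph.cycleGraph r).edgeSet.toFinset (by simp)),
    ∀ u₂ ∈ Set.range (cutGen k (SimpleGraph.cycleGraph r)
        (SimpleGraph.cycleGraph r).edgeSet.toFinset (by simp)),
    ∀ v w : ↥(SimpleGraph.cycleGraph r).edgeSet × Bool,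
      (X v : MvPolynomial (↥(SimpleGraph.cycleGraph r).edgeSet × Bool) k) * u₁ = X w * u₂ →
        u₁ = u₂ ∧ (X v : MvPolynomial (↥(SimpleGraph.cycleGraph r).edgeSet × Bool) k) = X w := by
  obtain ⟨n, rfl⟩ : ∃ n, r = n + 3 := ⟨r - 3, by omega⟩
  rintro _ ⟨A, rfl⟩ _ ⟨B, rfl⟩ v w h
  have hd := diff_edge_aux k _ _ _ A B v w h
  obtain ⟨i0, hi0⟩ := cycle_edge_aux n w.1 w.1.2
  have hoff : ∀ i, i ≠ i0 → crossBool A s(i,i+1) = crossBool B s(i,i+1) := by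
    intro i hi
    by_contra hc
    have h1 := hd s(i,i+1) (Set.mem_toFinset.2 (cycle_edge_mem_aux n i)) hc
    exact hi (cycle_edge_inj_aux n i i0 (h1.symm.trans hi0))
  have h0 := cross_parity_aux n A B i0 hoff
  have hall : ∀ e ∈ (SimpleGraph.cycleGraph (n+3)).edgeSet, crossBool A e = crossBool B e := by
    intro e he
    obtain ⟨i, rfl⟩ := cycle_edge_aux n e he
    by_cases hi : i = i0
    · rw [hi]; exact h0
    · exact hoff i hi
  have hu : cutGen k (SimpleGraph.cycleGraph (n+3))
        (SimpleGraph.cycleGraph (n+3)).edgeSet.toFinset (by simp) A =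
      cutGen k (SimpleGraph.cycleGraph (n+3))
        (SimpleGraph.cycleGraph (n+3)).edgeSet.toFinset (by simp) B := by
    unfold cutGen
    refine Finset.prod_congr rfl ?_
    rintro ⟨e, he⟩ -
    rw [hall e (Set.mem_toFinset.1 he)]
  refine ⟨hu, ?_⟩
  rw [hu] at h
  refine mul_right_cancel₀ ?_ h
  unfold cutGen
  exact Finset.prod_ne_zero_iff.2 (fun _ _ => X_ne_zero _)
end
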